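/- arXiv:2502.19139 — 5 statements merged into one kernel-verified Lean document; each statement's English description precedes it below -/
import Mathlib

section
/- In the algebra Ū the following hold: (1) [T, G₀] = [T, A] = 0, i.e. every element of T commutes with G₀ and with every element of A; (2) T is a Lie super subalgebra of Ū (under the supercommutator), with brackets [X_i,X_j] = −jX_j + iX_i + (j−i)X_{i+j}, [X_i,Y_j] = −jY_j + (i/2)Y_i + (j−i/2)Y_{i+j}, [Y_i,Y_j] = 2(X_i + X_j − X_{i+j}) for i,j ∈ ℤ∖{0}. -/
/-!
The algebra `Ū`: the quotient of the universal enveloping algebra of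
`g̃ = g ⋉ A` (with `g = s̄ ⋉ (ġ ⊗ A)`) by the ideal generated by
`tⁱ·tʲ − t^{i+j}`, `t⁰ − 1`, `tⁱ·ξ − tⁱξ`, `ξ·ξ`.  It is presented as the
quotient of the free algebra on the generators `L i, G i, x ⊗ tⁱ, x ⊗ tⁱξ, tⁱ,
tⁱξ` by the supercommutator relations of `g̃`, the linearity relations in
`x ∈ ġ`, and the above ideal relations.
-/

noncomputable section

open Module

/-- Generators: `L i`, `G i`, `E i x = x ⊗ tⁱ`, `F i x = x ⊗ tⁱξ`, `t i = tⁱ`,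
`xi i = tⁱξ`. -/
inductive UGen (𝕘 : Type) : Type
  | L : ℤ → UGen 𝕘
  | G : ℤ → UGen 𝕘
  | E : ℤ → 𝕘 → UGen 𝕘
  | F : ℤ → 𝕘 → UGen 𝕘
  | t : ℤ → UGen 𝕘
  | xi : ℤ → UGen 𝕘

/-- The free algebra on the generators. -/
abbrev UFree (𝕘 : Type) : Type := FreeAlgebra ℂ (UGen 𝕘)

variable {𝕘 : Type} [LieRing 𝕘] [LieAlgebra ℂ 𝕘]

def fL (i : ℤ) : UFree 𝕘 := FreeAlgebra.ι ℂ (UGen.L i)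
def fG (i : ℤ) : UFree 𝕘 := FreeAlgebra.ι ℂ (UGen.G i)
def fE (i : ℤ) (x : 𝕘) : UFree 𝕘 := FreeAlgebra.ι ℂ (UGen.E i x)
def fF (i : ℤ) (x : 𝕘) : UFree 𝕘 := FreeAlgebra.ι ℂ (UGen.F i x)
def ft (i : ℤ) : UFree 𝕘 := FreeAlgebra.ι ℂ (UGen.t i)
def fxi (i : ℤ) : UFree 𝕘 := FreeAlgebra.ι ℂ (UGen.xi i)

/-- The defining relations of `Ū`. -/
inductive URel (𝕘 : Type) [LieRing 𝕘] [LieAlgebra ℂ 𝕘] :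
    UFree 𝕘 → UFree 𝕘 → Prop
  -- supercommutator relations of `g`
  | LL (i j : ℤ) : URel 𝕘 (fL i * fL j - fL j * fL i) (((j : ℂ) - (i : ℂ)) • fL (i + j))
  | LG (i j : ℤ) : URel 𝕘 (fL i * fG j - fG j * fL i) (((j : ℂ) - (i : ℂ) / 2) • fG (i + j))
  | GG (i j : ℤ) : URel 𝕘 (fG i * fG j + fG j * fG i) ((-2 : ℂ) • fL (i + j))
  | LE (i j : ℤ) (x : 𝕘) :
      URel 𝕘 (fL i * fE j x - fE j x * fL i) ((j : ℂ) • fE (i + j) x)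
  | LF (i j : ℤ) (x : 𝕘) :
      URel 𝕘 (fL i * fF j x - fF j x * fL i) (((j : ℂ) + (i : ℂ) / 2) • fF (i + j) x)
  | GE (i j : ℤ) (x : 𝕘) :
      URel 𝕘 (fG i * fE j x - fE j x * fG i) ((j : ℂ) • fF (i + j) x)
  | GF (i j : ℤ) (x : 𝕘) :
      URel 𝕘 (fG i * fF j x + fF j x * fG i) (- fE (i + j) x)
  | EE (i j : ℤ) (x y : 𝕘) :
      URel 𝕘 (fE i x * fE j y - fE j y * fE i x) (fE (i + j) ⁅x, y⁆)
  | FE (i j : ℤ) (x y : 𝕘) :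
      URel 𝕘 (fF i x * fE j y - fE j y * fF i x) (fF (i + j) ⁅x, y⁆)
  | FF (i j : ℤ) (x y : 𝕘) :
      URel 𝕘 (fF i x * fF j y + fF j y * fF i x) 0
  -- the action of `g` on `A`
  | Lt (i j : ℤ) : URel 𝕘 (fL i * ft j - ft j * fL i) ((j : ℂ) • ft (i + j))
  | Lxi (i j : ℤ) :
      URel 𝕘 (fL i * fxi j - fxi j * fL i) (((j : ℂ) + (i : ℂ) / 2) • fxi (i + j))
  | Gt (i j : ℤ) : URel 𝕘 (fG i * ft j - ft j * fG i) ((j : ℂ) • fxi (i + j))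
  | Gxi (i j : ℤ) : URel 𝕘 (fG i * fxi j + fxi j * fG i) (- ft (i + j))
  | Et (i j : ℤ) (x : 𝕘) : URel 𝕘 (fE i x * ft j - ft j * fE i x) 0
  | Exi (i j : ℤ) (x : 𝕘) : URel 𝕘 (fE i x * fxi j - fxi j * fE i x) 0
  | Ft (i j : ℤ) (x : 𝕘) : URel 𝕘 (fF i x * ft j - ft j * fF i x) 0
  | Fxi (i j : ℤ) (x : 𝕘) : URel 𝕘 (fF i x * fxi j + fxi j * fF i x) 0
  -- `A` is (super)commutative
  | tt (i j : ℤ) : URel 𝕘 (ft i * ft j - ft j * ft i) 0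
  | txiComm (i j : ℤ) : URel 𝕘 (ft i * fxi j - fxi j * ft i) 0
  | xixi (i j : ℤ) : URel 𝕘 (fxi i * fxi j + fxi j * fxi i) 0
  -- linearity of `x ⊗ tⁱ` and `x ⊗ tⁱξ` in `x`
  | Eadd (i : ℤ) (x y : 𝕘) : URel 𝕘 (fE i (x + y)) (fE i x + fE i y)
  | Esmul (i : ℤ) (c : ℂ) (x : 𝕘) : URel 𝕘 (fE i (c • x)) (c • fE i x)
  | Fadd (i : ℤ) (x y : 𝕘) : URel 𝕘 (fF i (x + y)) (fF i x + fF i y)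
  | Fsmul (i : ℤ) (c : ℂ) (x : 𝕘) : URel 𝕘 (fF i (c • x)) (c • fF i x)
  -- the ideal `I`: `tⁱ·tʲ = t^{i+j}`, `t⁰ = 1`, `tⁱ·ξ = tⁱξ`, `ξ·ξ = 0`
  | tmul (i j : ℤ) : URel 𝕘 (ft i * ft j) (ft (i + j))
  | tone : URel 𝕘 (ft 0) 1
  | txi (i : ℤ) : URel 𝕘 (ft i * fxi 0) (fxi i)
  | xisq : URel 𝕘 (fxi 0 * fxi 0) 0

/-- The algebra `Ū`. -/
abbrev UBar (𝕘 : Type) [LieRing 𝕘] [LieAlgebra ℂ 𝕘] : Type := RingQuot (URel 𝕘)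

/-- Canonical map `UFree 𝕘 → Ū`. -/
def uof : UFree 𝕘 →ₐ[ℂ] UBar 𝕘 := RingQuot.mkAlgHom ℂ (URel 𝕘)

def uL (i : ℤ) : UBar 𝕘 := uof (fL i)
def uG (i : ℤ) : UBar 𝕘 := uof (fG i)
def uE (i : ℤ) (x : 𝕘) : UBar 𝕘 := uof (fE i x)
def uF (i : ℤ) (x : 𝕘) : UBar 𝕘 := uof (fF i x)
def ut (i : ℤ) : UBar 𝕘 := uof (ft i)
def uxi (i : ℤ) : UBar 𝕘 := uof (fxi i)

/-- `X_i = t^{−i}·L_i + (i/2) t^{−i}ξ·G_i − L₀`. -/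
def uX (i : ℤ) : UBar 𝕘 :=
  ut (-i) * uL i + ((i : ℂ) / 2) • (uxi (-i) * uG i) - uL 0

/-- `Y_i = t^{−i}·G_i − 2 t^{−i}ξ·L_i − G₀ + 2 ξ·L₀`. -/
def uY (i : ℤ) : UBar 𝕘 :=
  ut (-i) * uG i - (2 : ℂ) • (uxi (-i) * uL i) - uG 0 + (2 : ℂ) • (uxi 0 * uL 0)

/-- `X̄_m^x = t^{−m}·(x ⊗ tᵐ) + m t^{−m}ξ·(x ⊗ tᵐξ)`. -/
def uXB (m : ℤ) (x : 𝕘) : UBar 𝕘 :=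
  ut (-m) * uE m x + (m : ℂ) • (uxi (-m) * uF m x)

/-- `Ȳ_m^x = t^{−m}ξ·(x ⊗ tᵐ) − t^{−m}·(x ⊗ tᵐξ)`. -/
def uYB (m : ℤ) (x : 𝕘) : UBar 𝕘 :=
  uxi (-m) * uE m x - ut (-m) * uF m x

/-- The subspace `T ⊆ Ū` spanned by the `X_i, Y_i (i ≠ 0)` and `X̄_m^x, Ȳ_m^x`. -/
def TSpan (𝕘 : Type) [LieRing 𝕘] [LieAlgebra ℂ 𝕘] : Submodule ℂ (UBar 𝕘) :=
  Submodule.span ℂ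
    ({u | ∃ i : ℤ, i ≠ 0 ∧ u = uX i} ∪ {u | ∃ i : ℤ, i ≠ 0 ∧ u = uY i}
      ∪ {u | ∃ (m : ℤ) (x : 𝕘), u = uXB m x} ∪ {u | ∃ (m : ℤ) (x : 𝕘), u = uYB m x})

namespace UBar

theorem rel {a b : UFree 𝕘} (h : URel 𝕘 a b) : (uof a : UBar 𝕘) = uof b :=
  RingQuot.mkAlgHom_rel ℂ h

theorem mul_of_comm {a b c : UFree 𝕘} (h : URel 𝕘 (a * b - b * a) c) :
    (uof a * uof b : UBar 𝕘) = uof b * uof a + uof c := by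
  rw [← rel h, map_sub, map_mul, map_mul]; abel

theorem mul_of_comm_smul {a b c : UFree 𝕘} {r : ℂ} (h : URel 𝕘 (a * b - b * a) (r • c)) :
    (uof a * uof b : UBar 𝕘) = uof b * uof a + r • uof c := by
  rw [mul_of_comm h, map_smul]

theorem mul_of_comm_zero {a b : UFree 𝕘} (h : URel 𝕘 (a * b - b * a) 0) :
    (uof a * uof b : UBar 𝕘) = uof b * uof a := by
  rw [mul_of_comm h, map_zero, add_zero]

theorem mul_of_anticomm {a b c : UFree 𝕘} (h : URel 𝕘 (a * b + b * a) c) :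
    (uof a * uof b : UBar 𝕘) = -(uof b * uof a) + uof c := by
  rw [← rel h, map_add, map_mul, map_mul]; abel

theorem mul_of_anticomm_zero {a b : UFree 𝕘} (h : URel 𝕘 (a * b + b * a) 0) :
    (uof a * uof b : UBar 𝕘) = -(uof b * uof a) := by
  rw [mul_of_anticomm h, map_zero, add_zero]

/-! ### Multiplication in `A` -/

theorem ut_zero : (ut 0 : UBar 𝕘) = 1 := (rel .tone).trans (map_one _)

theorem ut_mul_ut (i j : ℤ) : (ut i * ut j : UBar 𝕘) = ut (i + j) :=
  (map_mul _ _ _).symm.trans (rel (.tmul i j))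

theorem ut_mul_uxi_zero (i : ℤ) : (ut i * uxi 0 : UBar 𝕘) = uxi i :=
  (map_mul _ _ _).symm.trans (rel (.txi i))

theorem ut_mul_uxi (i j : ℤ) : (ut i * uxi j : UBar 𝕘) = uxi (i + j) := by
  rw [← ut_mul_uxi_zero j, ← mul_assoc, ut_mul_ut, ut_mul_uxi_zero]

theorem uxi_mul_ut (i j : ℤ) : (uxi i * ut j : UBar 𝕘) = uxi (i + j) := by
  rw [add_comm, ← ut_mul_uxi]
  exact (mul_of_comm_zero (.txiComm j i)).symm

theorem uxi_mul_uxi (i j : ℤ) : (uxi i * uxi j : UBar 𝕘) = 0 := by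
  have h : (uxi 0 * uxi 0 : UBar 𝕘) = 0 := 
    (map_mul _ _ _).symm.trans ((rel .xisq).trans (map_zero _))
  rw [← ut_mul_uxi_zero j, ← mul_assoc, uxi_mul_ut, ← ut_mul_uxi_zero (i + j), mul_assoc, h,
    mul_zero]

/-! ### Moving the elements of `A` to the left -/

theorem uL_mul_ut (i j : ℤ) :
    (uL i * ut j : UBar 𝕘) = ut j * uL i + (j : ℂ) • ut (i + j) :=
  mul_of_comm_smul (.Lt i j)

theorem uL_mul_uxi (i j : ℤ) :
    (uL i * uxi j : UBar 𝕘) = uxi j * uL i + ((j : ℂ) + (i : ℂ) / 2) • uxi (i + j) :=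
  mul_of_comm_smul (.Lxi i j)

theorem uG_mul_ut (i j : ℤ) :
    (uG i * ut j : UBar 𝕘) = ut j * uG i + (j : ℂ) • uxi (i + j) :=
  mul_of_comm_smul (.Gt i j)

theorem uG_mul_uxi (i j : ℤ) :
    (uG i * uxi j : UBar 𝕘) = -(uxi j * uG i) + -ut (i + j) := by
  simpa only [map_neg] using! mul_of_anticomm (URel.Gxi (𝕘 := 𝕘) i j)

theorem uE_mul_ut (i j : ℤ) (x : 𝕘) : uE i x * ut j = ut j * uE i x :=
  mul_of_comm_zero (.Et i j x)

theorem uE_mul_uxi (i j : ℤ) (x : 𝕘) : uE i x * uxi j = uxi j * uE i x :=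
  mul_of_comm_zero (.Exi i j x)

theorem uF_mul_ut (i j : ℤ) (x : 𝕘) : uF i x * ut j = ut j * uF i x :=
  mul_of_comm_zero (.Ft i j x)

theorem uF_mul_uxi (i j : ℤ) (x : 𝕘) : uF i x * uxi j = -(uxi j * uF i x) :=
  mul_of_anticomm_zero (.Fxi i j x)

/-! ### Supercommutators in `g` -/

theorem uL_mul_uL (i j : ℤ) :
    (uL i * uL j : UBar 𝕘) = uL j * uL i + ((j : ℂ) - (i : ℂ)) • uL (i + j) :=
  mul_of_comm_smul (.LL i j)

theorem uL_mul_uG (i j : ℤ) :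
    (uL i * uG j : UBar 𝕘) = uG j * uL i + ((j : ℂ) - (i : ℂ) / 2) • uG (i + j) :=
  mul_of_comm_smul (.LG i j)

theorem uG_mul_uG (i j : ℤ) :
    (uG i * uG j : UBar 𝕘) = -(uG j * uG i) + (-2 : ℂ) • uL (i + j) := by
  simpa only [map_smul] using! mul_of_anticomm (URel.GG (𝕘 := 𝕘) i j)

theorem uG_zero_mul_uG_zero : (uG 0 * uG 0 : UBar 𝕘) = -uL 0 := by
  have h := uG_mul_uG (𝕘 := 𝕘) 0 0
  rw [add_zero] at h
  have h2 : (2 : ℂ) • (uG 0 * uG 0 : UBar 𝕘) = (2 : ℂ) • -uL 0 := by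
    rw [two_smul]
    nth_rewrite 1 [h]
    module
  exact smul_right_injective _ (two_ne_zero' ℂ) h2

theorem uL_mul_uE (i j : ℤ) (x : 𝕘) :
    uL i * uE j x = uE j x * uL i + (j : ℂ) • uE (i + j) x :=
  mul_of_comm_smul (.LE i j x)

theorem uL_mul_uF (i j : ℤ) (x : 𝕘) :
    uL i * uF j x = uF j x * uL i + ((j : ℂ) + (i : ℂ) / 2) • uF (i + j) x :=
  mul_of_comm_smul (.LF i j x)

theorem uG_mul_uE (i j : ℤ) (x : 𝕘) :
    uG i * uE j x = uE j x * uG i + (j : ℂ) • uF (i + j) x :=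
  mul_of_comm_smul (.GE i j x)

theorem uG_mul_uF (i j : ℤ) (x : 𝕘) :
    uG i * uF j x = -(uF j x * uG i) + -uE (i + j) x := by
  simpa only [map_neg] using! mul_of_anticomm (URel.GF i j x)

theorem uE_mul_uE (i j : ℤ) (x y : 𝕘) :
    uE i x * uE j y = uE j y * uE i x + uE (i + j) ⁅x, y⁆ :=
  mul_of_comm (.EE i j x y)

theorem uF_mul_uE (i j : ℤ) (x y : 𝕘) :
    uF i x * uE j y = uE j y * uF i x + uF (i + j) ⁅x, y⁆ :=
  mul_of_comm (.FE i j x y)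

theorem uE_mul_uF (i j : ℤ) (x y : 𝕘) :
    uE i x * uF j y = uF j y * uE i x + uF (i + j) ⁅x, y⁆ := by
  have h : uF (j + i) ⁅y, x⁆ = -uF (i + j) ⁅x, y⁆ := by
    have h' : uF (i + j) ((-1 : ℂ) • ⁅x, y⁆) = (-1 : ℂ) • uF (i + j) ⁅x, y⁆ :=
      (rel (.Fsmul _ _ _)).trans (map_smul _ _ _)
    rw [neg_one_smul, lie_skew] at h'
    rw [add_comm j i]
    exact h'.trans (by module)
  rw [uF_mul_uE, h]
  abel

theorem uF_mul_uF (i j : ℤ) (x y : 𝕘) : uF i x * uF j y = -(uF j y * uF i x) :=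
  mul_of_anticomm_zero (.FF i j x y)

theorem mul_mul_of_eq {R : Type*} [Semigroup R] {a b c : R} (h : a * b = c) (d : R) :
    a * (b * d) = c * d := by
  rw [← mul_assoc, h]

theorem ut_mul_ut_mul (i j : ℤ) (w : UBar 𝕘) : ut i * (ut j * w) = ut (i + j) * w :=
  mul_mul_of_eq (ut_mul_ut i j) w

theorem ut_mul_uxi_mul (i j : ℤ) (w : UBar 𝕘) : ut i * (uxi j * w) = uxi (i + j) * w :=
  mul_mul_of_eq (ut_mul_uxi i j) w

theorem uxi_mul_ut_mul (i j : ℤ) (w : UBar 𝕘) : uxi i * (ut j * w) = uxi (i + j) * w :=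
  mul_mul_of_eq (uxi_mul_ut i j) w

theorem uxi_mul_uxi_mul (i j : ℤ) (w : UBar 𝕘) : uxi i * (uxi j * w) = 0 :=
  (mul_mul_of_eq (uxi_mul_uxi i j) w).trans (zero_mul w)

theorem uL_mul_ut_mul (i j : ℤ) (w : UBar 𝕘) :
    uL i * (ut j * w) = (ut j * uL i + (j : ℂ) • ut (i + j)) * w :=
  mul_mul_of_eq (uL_mul_ut i j) w

theorem uL_mul_uxi_mul (i j : ℤ) (w : UBar 𝕘) :
    uL i * (uxi j * w) = (uxi j * uL i + ((j : ℂ) + (i : ℂ) / 2) • uxi (i + j)) * w :=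
  mul_mul_of_eq (uL_mul_uxi i j) w

theorem uG_mul_ut_mul (i j : ℤ) (w : UBar 𝕘) :
    uG i * (ut j * w) = (ut j * uG i + (j : ℂ) • uxi (i + j)) * w :=
  mul_mul_of_eq (uG_mul_ut i j) w

theorem uG_mul_uxi_mul (i j : ℤ) (w : UBar 𝕘) :
    uG i * (uxi j * w) = (-(uxi j * uG i) + -ut (i + j)) * w :=
  mul_mul_of_eq (uG_mul_uxi i j) w

theorem uE_mul_ut_mul (i j : ℤ) (x : 𝕘) (w : UBar 𝕘) :
    uE i x * (ut j * w) = ut j * uE i x * w :=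
  mul_mul_of_eq (uE_mul_ut i j x) w

theorem uE_mul_uxi_mul (i j : ℤ) (x : 𝕘) (w : UBar 𝕘) :
    uE i x * (uxi j * w) = uxi j * uE i x * w :=
  mul_mul_of_eq (uE_mul_uxi i j x) w

theorem uF_mul_ut_mul (i j : ℤ) (x : 𝕘) (w : UBar 𝕘) :
    uF i x * (ut j * w) = ut j * uF i x * w :=
  mul_mul_of_eq (uF_mul_ut i j x) w

theorem uF_mul_uxi_mul (i j : ℤ) (x : 𝕘) (w : UBar 𝕘) :
    uF i x * (uxi j * w) = -(uxi j * uF i x) * w :=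
  mul_mul_of_eq (uF_mul_uxi i j x) w

/-- `neg_mul` with the instances of `Ū` fixed, so that `simp` can use it. -/
theorem ubar_neg_mul (a b : UBar 𝕘) : -a * b = -(a * b) := neg_mul a b

theorem ubar_mul_neg (a b : UBar 𝕘) : a * -b = -(a * b) := mul_neg a b

section Normalization

attribute [local simp] ut_mul_ut ut_mul_uxi uxi_mul_ut uxi_mul_uxi uL_mul_ut uL_mul_uxi uG_mul_ut
  uG_mul_uxi uE_mul_ut uE_mul_uxi uF_mul_ut uF_mul_uxi ut_mul_ut_mul ut_mul_uxi_mul uxi_mul_ut_mul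
  uxi_mul_uxi_mul uL_mul_ut_mul uL_mul_uxi_mul uG_mul_ut_mul uG_mul_uxi_mul uE_mul_ut_mul
  uE_mul_uxi_mul uF_mul_ut_mul uF_mul_uxi_mul uL_mul_uG uL_mul_uE uL_mul_uF uG_mul_uE uG_mul_uF
  ubar_neg_mul ubar_mul_neg mul_add add_mul mul_sub sub_mul mul_assoc uX uY uXB uYB

theorem uX_mul_ut (i n : ℤ) : uX (𝕘 := 𝕘) i * ut n = ut n * uX i := by
  simp
  ring_nf
  module

theorem uX_mul_uxi (i n : ℤ) : uX (𝕘 := 𝕘) i * uxi n = uxi n * uX i := by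
  simp
  ring_nf
  module

theorem uY_mul_ut (i n : ℤ) : uY (𝕘 := 𝕘) i * ut n = ut n * uY i := by
  simp
  ring_nf
  module

theorem uY_mul_uxi (i n : ℤ) : uY (𝕘 := 𝕘) i * uxi n + uxi n * uY i = 0 := by
  simp
  ring_nf
  module

theorem uX_mul_uG_zero (i : ℤ) : uX (𝕘 := 𝕘) i * uG 0 = uG 0 * uX i := by
  simp [uG_mul_uG 0 i]
  module

theorem uY_mul_uG_zero (i : ℤ) : uY (𝕘 := 𝕘) i * uG 0 + uG 0 * uY i = 0 := by
  simp [uG_mul_uG 0 i, uG_zero_mul_uG_zero, ut_zero]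
  module

theorem uXB_mul_ut (m n : ℤ) (x : 𝕘) : uXB m x * ut n = ut n * uXB m x := by
  simp
  ring_nf

theorem uXB_mul_uxi (m n : ℤ) (x : 𝕘) : uXB m x * uxi n = uxi n * uXB m x := by
  simp
  ring_nf

theorem uYB_mul_ut (m n : ℤ) (x : 𝕘) : uYB m x * ut n = ut n * uYB m x := by
  simp
  ring_nf

theorem uYB_mul_uxi (m n : ℤ) (x : 𝕘) : uYB m x * uxi n + uxi n * uYB m x = 0 := by
  simp
  ring_nf
  module

theorem uXB_mul_uG_zero (m : ℤ) (x : 𝕘) : uXB m x * uG 0 = uG 0 * uXB m x := by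
  simp
  module

theorem uYB_mul_uG_zero (m : ℤ) (x : 𝕘) : uYB m x * uG 0 + uG 0 * uYB m x = 0 := by
  simp
  module

theorem uX_comm_uX (i j : ℤ) :
    uX (𝕘 := 𝕘) i * uX j - uX j * uX i
      = (-(j : ℂ)) • uX j + (i : ℂ) • uX i + ((j : ℂ) - (i : ℂ)) • uX (i + j) := by
  simp [uL_mul_uL i j, uL_mul_uL 0 j, uL_mul_uL i 0]
  ring_nf
  module

theorem uX_comm_uY (i j : ℤ) :
    uX (𝕘 := 𝕘) i * uY j - uY j * uX i
      = (-(j : ℂ)) • uY j + ((i : ℂ) / 2) • uY i + ((j : ℂ) - (i : ℂ) / 2) • uY (i + j) := by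
  simp [uL_mul_uL i j, uL_mul_uL 0 j, uL_mul_uL i 0, uG_mul_uG i j, uG_mul_uG i 0]
  ring_nf
  module

theorem uY_anticomm_uY (i j : ℤ) :
    uY (𝕘 := 𝕘) i * uY j + uY j * uY i = (2 : ℂ) • (uX i + uX j - uX (i + j)) := by
  simp [uL_mul_uL i j, uL_mul_uL 0 j, uL_mul_uL i 0, uG_mul_uG i j, uG_mul_uG i 0, uG_mul_uG 0 j,
    uG_zero_mul_uG_zero]
  ring_nf
  module

theorem uX_comm_uXB (i m : ℤ) (x : 𝕘) :
    uX i * uXB m x - uXB m x * uX i = (m : ℂ) • (uXB (m + i) x - uXB m x) := by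
  simp
  ring_nf
  module

theorem uX_comm_uYB (i m : ℤ) (x : 𝕘) :
    uX i * uYB m x - uYB m x * uX i
      = ((m : ℂ) + (i : ℂ) / 2) • uYB (m + i) x - (m : ℂ) • uYB m x := by
  simp
  ring_nf
  module

theorem uY_comm_uXB (i m : ℤ) (x : 𝕘) :
    uY i * uXB m x - uXB m x * uY i = (m : ℂ) • (uYB m x - uYB (m + i) x) := by
  simp
  ring_nf
  module

theorem uY_anticomm_uYB (i m : ℤ) (x : 𝕘) :
    uY i * uYB m x + uYB m x * uY i = uXB (m + i) x - uXB m x := by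
  simp
  ring_nf
  module

theorem uXB_comm_uXB (m n : ℤ) (x y : 𝕘) :
    uXB m x * uXB n y - uXB n y * uXB m x = uXB (m + n) ⁅x, y⁆ := by
  simp [uE_mul_uE m n x y, uF_mul_uE m n x y, uE_mul_uF m n x y]
  ring_nf
  module

theorem uXB_comm_uYB (m n : ℤ) (x y : 𝕘) :
    uXB m x * uYB n y - uYB n y * uXB m x = uYB (m + n) ⁅x, y⁆ := by
  simp [uE_mul_uE m n x y, uF_mul_uE m n x y, uE_mul_uF m n x y, uF_mul_uF m n x y]
  ring_nf
  module

theorem uYB_anticomm_uYB (m n : ℤ) (x y : 𝕘) :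
    uYB m x * uYB n y + uYB n y * uYB m x = 0 := by
  simp [uE_mul_uE m n x y, uF_mul_uE m n x y, uE_mul_uF m n x y, uF_mul_uF m n x y]
  ring_nf
  module

end Normalization

theorem uXB_mem (m : ℤ) (x : 𝕘) : uXB m x ∈ TSpan 𝕘 :=
  Submodule.subset_span (Or.inl (Or.inr ⟨m, x, rfl⟩))

theorem uYB_mem (m : ℤ) (x : 𝕘) : uYB m x ∈ TSpan 𝕘 :=
  Submodule.subset_span (Or.inr ⟨m, x, rfl⟩)

end UBar

/-- **Statement 8.** In `Ū`:
(1) `[T, G₀] = [T, A] = 0`: every element of `T` (super)commutes with `G₀` and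
with every element of `A` (spanned by the `tⁿ` and `tⁿξ`);
(2) `T` is a Lie super subalgebra of `Ū` under the supercommutator, with
brackets `[X_i, X_j] = −j X_j + i X_i + (j−i) X_{i+j}`,
`[X_i, Y_j] = −j Y_j + (i/2) Y_i + (j − i/2) Y_{i+j}` and
`[Y_i, Y_j] = 2 (X_i + X_j − X_{i+j})` for `i, j ∈ ℤ∖{0}`
(the supercommutators of all the spanning elements lie in `T`). -/
theorem T_supercommutes_with_A_and_is_subalgebra
    (𝕘 : Type) [LieRing 𝕘] [LieAlgebra ℂ 𝕘] [FiniteDimensional ℂ 𝕘]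
    [LieAlgebra.IsSimple ℂ 𝕘] :
    -- (1) for the `X_i, Y_i`
    (∀ i : ℤ, i ≠ 0 →
      uX (𝕘 := 𝕘) i * uG 0 = uG 0 * uX i ∧
      uY (𝕘 := 𝕘) i * uG 0 + uG 0 * uY i = 0 ∧
      (∀ n : ℤ,
        uX (𝕘 := 𝕘) i * ut n = ut n * uX i ∧
        uX (𝕘 := 𝕘) i * uxi n = uxi n * uX i ∧
        uY (𝕘 := 𝕘) i * ut n = ut n * uY i ∧
        uY (𝕘 := 𝕘) i * uxi n + uxi n * uY i = 0)) ∧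
    -- (1) for the `X̄_m^x, Ȳ_m^x`
    (∀ (m : ℤ) (x : 𝕘),
      uXB m x * uG 0 = uG 0 * uXB m x ∧
      uYB m x * uG 0 + uG 0 * uYB m x = 0 ∧
      (∀ n : ℤ,
        uXB m x * ut n = ut n * uXB m x ∧
        uXB m x * uxi n = uxi n * uXB m x ∧
        uYB m x * ut n = ut n * uYB m x ∧
        uYB m x * uxi n + uxi n * uYB m x = 0)) ∧
    -- (2) the explicit brackets
    (∀ i j : ℤ, i ≠ 0 → j ≠ 0 →
      uX (𝕘 := 𝕘) i * uX j - uX j * uX i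
        = (-(j : ℂ)) • uX j + (i : ℂ) • uX i + ((j : ℂ) - (i : ℂ)) • uX (i + j) ∧
      uX (𝕘 := 𝕘) i * uY j - uY j * uX i
        = (-(j : ℂ)) • uY j + ((i : ℂ) / 2) • uY i + ((j : ℂ) - (i : ℂ) / 2) • uY (i + j) ∧
      uY (𝕘 := 𝕘) i * uY j + uY j * uY i
        = (2 : ℂ) • (uX i + uX j - uX (i + j))) ∧
    -- (2) closure of `T` under the supercommutator (the remaining pairs)
    (∀ (i : ℤ) (m : ℤ) (x : 𝕘), i ≠ 0 →
      uX i * uXB m x - uXB m x * uX i ∈ TSpan 𝕘 ∧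
      uX i * uYB m x - uYB m x * uX i ∈ TSpan 𝕘 ∧
      uY i * uXB m x - uXB m x * uY i ∈ TSpan 𝕘 ∧
      uY i * uYB m x + uYB m x * uY i ∈ TSpan 𝕘) ∧
    (∀ (m n : ℤ) (x y : 𝕘),
      uXB m x * uXB n y - uXB n y * uXB m x ∈ TSpan 𝕘 ∧
      uXB m x * uYB n y - uYB n y * uXB m x ∈ TSpan 𝕘 ∧
      uYB m x * uYB n y + uYB n y * uYB m x ∈ TSpan 𝕘) := by
  refine ⟨fun i _ => ⟨UBar.uX_mul_uG_zero i, UBar.uY_mul_uG_zero i, fun n =>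
      ⟨UBar.uX_mul_ut i n, UBar.uX_mul_uxi i n, UBar.uY_mul_ut i n, UBar.uY_mul_uxi i n⟩⟩,
    fun m x => ⟨UBar.uXB_mul_uG_zero m x, UBar.uYB_mul_uG_zero m x, fun n =>
      ⟨UBar.uXB_mul_ut m n x, UBar.uXB_mul_uxi m n x, UBar.uYB_mul_ut m n x,
        UBar.uYB_mul_uxi m n x⟩⟩,
    fun i j _ _ => ⟨UBar.uX_comm_uX i j, UBar.uX_comm_uY i j, UBar.uY_anticomm_uY i j⟩,
    fun i m x _ => ⟨?_, ?_, ?_, ?_⟩, fun m n x y => ⟨?_, ?_, ?_⟩⟩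
  · rw [UBar.uX_comm_uXB]
    exact Submodule.smul_mem _ _ (sub_mem (UBar.uXB_mem _ _) (UBar.uXB_mem _ _))
  · rw [UBar.uX_comm_uYB]
    exact sub_mem (Submodule.smul_mem _ _ (UBar.uYB_mem _ _))
      (Submodule.smul_mem _ _ (UBar.uYB_mem _ _))
  · rw [UBar.uY_comm_uXB]
    exact Submodule.smul_mem _ _ (sub_mem (UBar.uYB_mem _ _) (UBar.uYB_mem _ _))
  · rw [UBar.uY_anticomm_uYB]
    exact sub_mem (UBar.uXB_mem _ _) (UBar.uXB_mem _ _)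
  · rw [UBar.uXB_comm_uXB]
    exact UBar.uXB_mem _ _
  · rw [UBar.uXB_comm_uYB]
    exact UBar.uYB_mem _ _
  · rw [UBar.uYB_anticomm_uYB]
    exact zero_mem _
end
end

section
/- In Ū, for i ∈ ℤ∖{0}, m,n ∈ ℤ and x,y ∈ ġ, the following supercommutator relations hold: [X_i, X̄_m^x] = −m X̄_m^x + m X̄_{i+m}^x; [X_i, Ȳ_m^x] = −m Ȳ_m^x + (i/2 + m) Ȳ_{i+m}^x; [Y_i, X̄_m^x] = m Ȳ_m^x − m Ȳ_{i+m}^x; [Y_i, Ȳ_m^x] = −X̄_m^x + X̄_{i+m}^x; [X̄_m^x, X̄_n^y] = X̄_{m+n}^{[x,y]}; [X̄_m^x, Ȳ_n^y] = Ȳ_{m+n}^{[x,y]}; [Ȳ_m^x, Ȳ_n^y] = 0. -/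
/-!
The algebra `Ū`: the quotient of the universal enveloping algebra of
`g̃ = g ⋉ A` (with `g = s̄ ⋉ (ġ ⊗ A)`) by the ideal generated by
`tⁱ·tʲ − t^{i+j}`, `t⁰ − 1`, `tⁱ·ξ − tⁱξ`, `ξ·ξ`.  It is presented as the
quotient of the free algebra on the generators `L i, G i, x ⊗ tⁱ, x ⊗ tⁱξ, tⁱ,
tⁱξ` by the supercommutator relations of `g̃`, the linearity relations in
`x ∈ ġ`, and the above ideal relations.
-/

noncomputable section

open Module

variable {𝕘 : Type} [LieRing 𝕘] [LieAlgebra ℂ 𝕘]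

theorem uof_eq_of_rel {a b : UFree 𝕘} (h : URel 𝕘 a b) : uof a = uof b :=
  RingQuot.mkAlgHom_rel ℂ h

theorem neg_eq_neg_one_smul (a : UBar 𝕘) : -a = (-1 : ℂ) • a :=
  (neg_one_smul ℂ a).symm

theorem ut_mul_ut (i j : ℤ) : (ut i * ut j : UBar 𝕘) = ut (i + j) := by
  rw [ut, ut, ← map_mul]
  exact uof_eq_of_rel (URel.tmul i j)

theorem ut_mul_uxi_zero (i : ℤ) : (ut i * uxi 0 : UBar 𝕘) = uxi i := by
  rw [ut, uxi, ← map_mul]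
  exact uof_eq_of_rel (URel.txi i)

theorem uxi_zero_mul_uxi_zero : (uxi 0 * uxi 0 : UBar 𝕘) = 0 := by
  rw [uxi, ← map_mul, ← map_zero uof]
  exact uof_eq_of_rel URel.xisq

theorem ut_mul_uxi (i j : ℤ) : (ut i * uxi j : UBar 𝕘) = uxi (i + j) := by
  rw [← ut_mul_uxi_zero j, ← mul_assoc, ut_mul_ut, ut_mul_uxi_zero]

theorem uxi_mul_ut (i j : ℤ) : (uxi i * ut j : UBar 𝕘) = uxi (i + j) := by
  have h := uof_eq_of_rel (URel.txiComm (𝕘 := 𝕘) j i)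
  rw [map_sub, map_mul, map_mul, map_zero, sub_eq_zero] at h
  exact h.symm.trans ((ut_mul_uxi j i).trans (by rw [add_comm]))

theorem uxi_mul_uxi (i j : ℤ) : (uxi i * uxi j : UBar 𝕘) = 0 := by
  rw [← ut_mul_uxi_zero i, ← ut_mul_uxi_zero j, mul_assoc, ← mul_assoc (uxi 0), uxi_mul_ut,
    zero_add, ← ut_mul_uxi_zero j, mul_assoc, uxi_zero_mul_uxi_zero, mul_zero, mul_zero]

theorem ut_mul_ut_assoc (i j : ℤ) (a : UBar 𝕘) : ut i * (ut j * a) = ut (i + j) * a := by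
  rw [← mul_assoc, ut_mul_ut]

theorem ut_mul_uxi_assoc (i j : ℤ) (a : UBar 𝕘) : ut i * (uxi j * a) = uxi (i + j) * a := by
  rw [← mul_assoc, ut_mul_uxi]

theorem uxi_mul_ut_assoc (i j : ℤ) (a : UBar 𝕘) : uxi i * (ut j * a) = uxi (i + j) * a := by
  rw [← mul_assoc, uxi_mul_ut]

theorem uxi_mul_uxi_assoc (i j : ℤ) (a : UBar 𝕘) : uxi i * (uxi j * a) = 0 := by
  rw [← mul_assoc, uxi_mul_uxi, zero_mul]

theorem uF_neg (i : ℤ) (x : 𝕘) : uF i (-x) = (-1 : ℂ) • uF i x := by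
  have h := uof_eq_of_rel (URel.Fsmul i (-1) x)
  rw [map_smul, neg_one_smul] at h
  exact h

theorem uE_mul_uL (i j : ℤ) (x : 𝕘) :
    (uE j x * uL i : UBar 𝕘) = uL i * uE j x - (j : ℂ) • uE (i + j) x := by
  have h := uof_eq_of_rel (URel.LE i j x)
  simp only [map_sub, map_mul, map_smul] at h
  exact eq_sub_of_add_eq (sub_eq_iff_eq_add'.mp h).symm

theorem uF_mul_uL (i j : ℤ) (x : 𝕘) :
    (uF j x * uL i : UBar 𝕘) = uL i * uF j x - ((j : ℂ) + (i : ℂ) / 2) • uF (i + j) x := by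
  have h := uof_eq_of_rel (URel.LF i j x)
  simp only [map_sub, map_mul, map_smul] at h
  exact eq_sub_of_add_eq (sub_eq_iff_eq_add'.mp h).symm

theorem uE_mul_uG (i j : ℤ) (x : 𝕘) :
    (uE j x * uG i : UBar 𝕘) = uG i * uE j x - (j : ℂ) • uF (i + j) x := by
  have h := uof_eq_of_rel (URel.GE i j x)
  simp only [map_sub, map_mul, map_smul] at h
  exact eq_sub_of_add_eq (sub_eq_iff_eq_add'.mp h).symm

theorem uF_mul_uG (i j : ℤ) (x : 𝕘) :
    (uF j x * uG i : UBar 𝕘) = (-1 : ℂ) • (uG i * uF j x) + - uE (i + j) x := by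
  have h := uof_eq_of_rel (URel.GF i j x)
  simp only [map_add, map_mul, map_neg] at h
  exact (eq_neg_add_of_add_eq h).trans
    (congrArg (· + _) (neg_eq_neg_one_smul _))

theorem uE_mul_uF (i j : ℤ) (x y : 𝕘) :
    (uE i x * uF j y : UBar 𝕘) = uF j y * uE i x + uF (i + j) ⁅x, y⁆ := by
  have h := uof_eq_of_rel (URel.FE j i y x)
  simp only [map_sub, map_mul] at h
  have hs : uF (i + j) ⁅x, y⁆ = -uof (fF (j + i) ⁅y, x⁆) := by
    rw [← lie_skew x y, uF_neg, add_comm i j, neg_eq_neg_one_smul]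
    rfl
  rw [hs, ← h, neg_sub]
  exact (add_sub_cancel _ _).symm

theorem uE_mul_uE (i j : ℤ) (x y : 𝕘) :
    (uE j y * uE i x : UBar 𝕘) = uE i x * uE j y - uE (i + j) ⁅x, y⁆ := by
  have h := uof_eq_of_rel (URel.EE i j x y)
  simp only [map_sub, map_mul] at h
  exact eq_sub_of_add_eq (sub_eq_iff_eq_add'.mp h).symm

theorem uF_mul_uF (i j : ℤ) (x y : 𝕘) :
    (uF i x * uF j y : UBar 𝕘) = (-1 : ℂ) • (uF j y * uF i x) := by
  have h := uof_eq_of_rel (URel.FF i j x y)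
  simp only [map_add, map_mul, map_zero] at h
  exact (eq_neg_of_add_eq_zero_left h).trans (neg_eq_neg_one_smul _)

theorem uL_mul_ut (i j : ℤ) :
    (uL i * ut j : UBar 𝕘) = ut j * uL i + (j : ℂ) • ut (i + j) := by
  have h := uof_eq_of_rel (URel.Lt i j (𝕘 := 𝕘))
  simp only [map_sub, map_mul, map_smul] at h
  exact eq_add_of_sub_eq' h

theorem uL_mul_ut_assoc (i j : ℤ) (a : UBar 𝕘) :
    uL i * (ut j * a) = (ut j * uL i + (j : ℂ) • ut (i + j)) * a := by
  rw [← mul_assoc, uL_mul_ut]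

theorem uL_mul_uxi (i j : ℤ) :
    (uL i * uxi j : UBar 𝕘) = uxi j * uL i + ((j : ℂ) + (i : ℂ) / 2) • uxi (i + j) := by
  have h := uof_eq_of_rel (URel.Lxi i j (𝕘 := 𝕘))
  simp only [map_sub, map_mul, map_smul] at h
  exact eq_add_of_sub_eq' h

theorem uL_mul_uxi_assoc (i j : ℤ) (a : UBar 𝕘) :
    uL i * (uxi j * a) = (uxi j * uL i + ((j : ℂ) + (i : ℂ) / 2) • uxi (i + j)) * a := by
  rw [← mul_assoc, uL_mul_uxi]

theorem uG_mul_ut (i j : ℤ) :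
    (uG i * ut j : UBar 𝕘) = ut j * uG i + (j : ℂ) • uxi (i + j) := by
  have h := uof_eq_of_rel (URel.Gt i j (𝕘 := 𝕘))
  simp only [map_sub, map_mul, map_smul] at h
  exact eq_add_of_sub_eq' h

theorem uG_mul_ut_assoc (i j : ℤ) (a : UBar 𝕘) :
    uG i * (ut j * a) = (ut j * uG i + (j : ℂ) • uxi (i + j)) * a := by
  rw [← mul_assoc, uG_mul_ut]

theorem uG_mul_uxi (i j : ℤ) :
    (uG i * uxi j : UBar 𝕘) = (-1 : ℂ) • (uxi j * uG i) + - ut (i + j) := by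
  have h := uof_eq_of_rel (URel.Gxi i j (𝕘 := 𝕘))
  simp only [map_add, map_mul, map_neg] at h
  exact (eq_neg_add_of_add_eq ((add_comm _ _).trans h)).trans
    (congrArg (· + _) (neg_eq_neg_one_smul _))

theorem uG_mul_uxi_assoc (i j : ℤ) (a : UBar 𝕘) :
    uG i * (uxi j * a) = ((-1 : ℂ) • (uxi j * uG i) + - ut (i + j)) * a := by
  rw [← mul_assoc, uG_mul_uxi]

theorem uE_mul_ut (i j : ℤ) (x : 𝕘) :
    (uE i x * ut j : UBar 𝕘) = ut j * uE i x := by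
  have h := uof_eq_of_rel (URel.Et i j x)
  simp only [map_sub, map_mul, map_zero] at h
  exact sub_eq_zero.mp h

theorem uE_mul_ut_assoc (i j : ℤ) (x : 𝕘) (a : UBar 𝕘) :
    uE i x * (ut j * a) = (ut j * uE i x) * a := by
  rw [← mul_assoc, uE_mul_ut]

theorem uE_mul_uxi (i j : ℤ) (x : 𝕘) :
    (uE i x * uxi j : UBar 𝕘) = uxi j * uE i x := by
  have h := uof_eq_of_rel (URel.Exi i j x)
  simp only [map_sub, map_mul, map_zero] at h
  exact sub_eq_zero.mp h

theorem uE_mul_uxi_assoc (i j : ℤ) (x : 𝕘) (a : UBar 𝕘) :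
    uE i x * (uxi j * a) = (uxi j * uE i x) * a := by
  rw [← mul_assoc, uE_mul_uxi]

theorem uF_mul_ut (i j : ℤ) (x : 𝕘) :
    (uF i x * ut j : UBar 𝕘) = ut j * uF i x := by
  have h := uof_eq_of_rel (URel.Ft i j x)
  simp only [map_sub, map_mul, map_zero] at h
  exact sub_eq_zero.mp h

theorem uF_mul_ut_assoc (i j : ℤ) (x : 𝕘) (a : UBar 𝕘) :
    uF i x * (ut j * a) = (ut j * uF i x) * a := by
  rw [← mul_assoc, uF_mul_ut]

theorem uF_mul_uxi (i j : ℤ) (x : 𝕘) :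
    (uF i x * uxi j : UBar 𝕘) = (-1 : ℂ) • (uxi j * uF i x) := by
  have h := uof_eq_of_rel (URel.Fxi i j x)
  simp only [map_add, map_mul, map_zero] at h
  exact (eq_neg_of_add_eq_zero_left h).trans (neg_eq_neg_one_smul _)

theorem uF_mul_uxi_assoc (i j : ℤ) (x : 𝕘) (a : UBar 𝕘) :
    uF i x * (uxi j * a) = ((-1 : ℂ) • (uxi j * uF i x)) * a := by
  rw [← mul_assoc, uF_mul_uxi]

/-- **Statement 9.** In `Ū`, for `i ∈ ℤ∖{0}`, `m, n ∈ ℤ` and `x, y ∈ ġ`: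
`[X_i, X̄_m^x] = −m X̄_m^x + m X̄_{i+m}^x`,
`[X_i, Ȳ_m^x] = −m Ȳ_m^x + (i/2 + m) Ȳ_{i+m}^x`,
`[Y_i, X̄_m^x] = m Ȳ_m^x − m Ȳ_{i+m}^x`,
`[Y_i, Ȳ_m^x] = −X̄_m^x + X̄_{i+m}^x`,
`[X̄_m^x, X̄_n^y] = X̄_{m+n}^{[x,y]}`,
`[X̄_m^x, Ȳ_n^y] = Ȳ_{m+n}^{[x,y]}`,
`[Ȳ_m^x, Ȳ_n^y] = 0`
(supercommutators: anticommutators for pairs of odd elements). -/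
theorem T_bracket_relations_mixed
    (𝕘 : Type) [LieRing 𝕘] [LieAlgebra ℂ 𝕘] [FiniteDimensional ℂ 𝕘]
    [LieAlgebra.IsSimple ℂ 𝕘] :
    (∀ (i m : ℤ) (x : 𝕘), i ≠ 0 →
      uX i * uXB m x - uXB m x * uX i
        = (-(m : ℂ)) • uXB m x + (m : ℂ) • uXB (i + m) x ∧
      uX i * uYB m x - uYB m x * uX i
        = (-(m : ℂ)) • uYB m x + ((i : ℂ) / 2 + (m : ℂ)) • uYB (i + m) x ∧
      uY i * uXB m x - uXB m x * uY i
        = (m : ℂ) • uYB m x - (m : ℂ) • uYB (i + m) x ∧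
      uY i * uYB m x + uYB m x * uY i
        = - uXB m x + uXB (i + m) x) ∧
    (∀ (m n : ℤ) (x y : 𝕘),
      uXB m x * uXB n y - uXB n y * uXB m x = uXB (m + n) ⁅x, y⁆ ∧
      uXB m x * uYB n y - uYB n y * uXB m x = uYB (m + n) ⁅x, y⁆ ∧
      uYB m x * uYB n y + uYB n y * uYB m x = 0) := by
  refine ⟨fun i m x _ => ⟨?_, ?_, ?_, ?_⟩, fun m n x y => ⟨?_, ?_, ?_⟩⟩
  iterate 4
    · simp only [uX, uY, uXB, uYB, mul_add, add_mul, mul_sub, sub_mul, mul_assoc, smul_mul_assoc,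
        mul_smul_comm, neg_eq_neg_one_smul, smul_add, smul_sub, smul_zero, ut_mul_ut_assoc,
        ut_mul_uxi_assoc, uxi_mul_ut_assoc, uxi_mul_uxi_assoc, uE_mul_uL, uF_mul_uL,
        uE_mul_uG, uF_mul_uG, uL_mul_ut_assoc, uL_mul_uxi_assoc, uG_mul_ut_assoc,
        uG_mul_uxi_assoc, uE_mul_ut_assoc, uE_mul_uxi_assoc, uF_mul_ut_assoc,
        uF_mul_uxi_assoc]
      push_cast
      ring_nf
      module
  iterate 3
    · simp only [uXB, uYB, mul_add, add_mul, mul_sub, sub_mul, mul_assoc, smul_mul_assoc,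
        mul_smul_comm, smul_add, smul_sub, smul_zero, ut_mul_ut_assoc, ut_mul_uxi_assoc,
        uxi_mul_ut_assoc, uxi_mul_uxi_assoc, uE_mul_uF, uE_mul_ut_assoc, uE_mul_uxi_assoc,
        uF_mul_ut_assoc, uF_mul_uxi_assoc,
        uE_mul_uE m n x y, uF_mul_uF n m y x, ← lie_skew y x, uF_neg]
      push_cast
      ring_nf
      module
end
end

section
/- For k ∈ ℤ₊ let a_k = (t−1)^{k+1}s̄ ⋉ (ġ⊗𝔪^k A) ⊆ g. Then: (1) a₀ is a Lie super subalgebra of g; (2) a_k is an ideal of a₀; (3) [a₁, a_k] ⊆ a_{k+1}; (4) the ideal of a₀ generated by (t−1)^k W contains a_k, where W = span{L_i : i∈ℤ} is the Witt algebra. -/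
/-!
The centerless superconformal current algebra `g = s̄ ⋉ (ġ ⊗ A)` realised
concretely: the four components of an element record the coefficients of the
`L_i`, the `G_i`, the `x ⊗ tᵐ` and the `x ⊗ tᵐξ` respectively, and the Lie
superbracket is given by bilinear extension of the structure constants.
-/

noncomputable section

open Module

variable {𝕘 : Type} [LieRing 𝕘] [LieAlgebra ℂ 𝕘]

/-- Underlying space of `g`. -/
abbrev GCar (𝕘 : Type) [LieRing 𝕘] [LieAlgebra ℂ 𝕘] : Type :=
  ((ℤ →₀ ℂ) × (ℤ →₀ ℂ)) × ((ℤ →₀ 𝕘) × (ℤ →₀ 𝕘))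

/-- The Lie superbracket of `g`, extended bilinearly from
`[L_i, L_j] = (j−i)L_{i+j}`, `[L_i, G_j] = (j−i/2)G_{i+j}`,
`[G_i, G_j] = −2L_{i+j}`, `[L_i, x⊗tʲ] = j·x⊗t^{i+j}`,
`[L_i, x⊗tʲξ] = (j+i/2)·x⊗t^{i+j}ξ`, `[G_i, x⊗tʲ] = j·x⊗t^{i+j}ξ`,
`[G_i, x⊗tʲξ] = −x⊗t^{i+j}`, `[x⊗tⁱ, y⊗tʲ] = [x,y]⊗t^{i+j}`,
`[x⊗tⁱξ, y⊗tʲ] = [x,y]⊗t^{i+j}ξ`, `[x⊗tⁱξ, y⊗tʲξ] = 0`. -/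
def gbr (u v : GCar 𝕘) : GCar 𝕘 :=
  ( ( -- `L`-component: from `[L,L]` and `[G,G]`
      (u.1.1.sum fun i a => v.1.1.sum fun j b =>
        Finsupp.single (i + j) (a * b * ((j : ℂ) - (i : ℂ))))
      + (u.1.2.sum fun i a => v.1.2.sum fun j b =>
        Finsupp.single (i + j) (a * b * (-2 : ℂ))) ,
      -- `G`-component: from `[L,G]` and `[G,L]`
      (u.1.1.sum fun i a => v.1.2.sum fun j b =>
        Finsupp.single (i + j) (a * b * ((j : ℂ) - (i : ℂ) / 2)))
      + (u.1.2.sum fun i a => v.1.1.sum fun j b =>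
        Finsupp.single (i + j) (a * b * (-((i : ℂ) - (j : ℂ) / 2)))) ),
    ( -- `E`-component: from `[L,E]`, `[E,L]`, `[G,F]`, `[F,G]`, `[E,E]`
      (u.1.1.sum fun i a => v.2.1.sum fun j x =>
        Finsupp.single (i + j) ((a * (j : ℂ)) • x))
      + (u.2.1.sum fun j x => v.1.1.sum fun i a =>
        Finsupp.single (j + i) ((-(a * (j : ℂ))) • x))
      + (u.1.2.sum fun i a => v.2.2.sum fun j x =>
        Finsupp.single (i + j) ((-a) • x))
      + (u.2.2.sum fun j x => v.1.2.sum fun i a =>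
        Finsupp.single (j + i) (a • x))
      + (u.2.1.sum fun i x => v.2.1.sum fun j y =>
        Finsupp.single (i + j) ⁅x, y⁆) ,
      -- `F`-component: from `[L,F]`, `[F,L]`, `[G,E]`, `[E,G]`, `[E,F]`, `[F,E]`
      (u.1.1.sum fun i a => v.2.2.sum fun j x =>
        Finsupp.single (i + j) ((a * ((j : ℂ) + (i : ℂ) / 2)) • x))
      + (u.2.2.sum fun j x => v.1.1.sum fun i a =>
        Finsupp.single (j + i) ((-(a * ((j : ℂ) + (i : ℂ) / 2))) • x))
      + (u.1.2.sum fun i a => v.2.1.sum fun j x =>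
        Finsupp.single (i + j) ((a * (j : ℂ)) • x))
      + (u.2.1.sum fun j x => v.1.2.sum fun i a =>
        Finsupp.single (j + i) ((-(a * (j : ℂ))) • x))
      + (u.2.1.sum fun i x => v.2.2.sum fun j y =>
        Finsupp.single (i + j) ⁅x, y⁆)
      + (u.2.2.sum fun i x => v.2.1.sum fun j y =>
        Finsupp.single (i + j) ⁅x, y⁆) ) )

/-- `(t−1)^k L_i ∈ g` (binomial expansion). -/
def tpL (k : ℕ) (i : ℤ) : GCar 𝕘 :=
  ((∑ s ∈ Finset.range (k + 1),
      Finsupp.single (i + (s : ℤ)) ((-1 : ℂ) ^ (k - s) * (k.choose s : ℂ)), 0), (0, 0))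

/-- `(t−1)^k G_i ∈ g`. -/
def tpG (k : ℕ) (i : ℤ) : GCar 𝕘 :=
  ((0, ∑ s ∈ Finset.range (k + 1),
      Finsupp.single (i + (s : ℤ)) ((-1 : ℂ) ^ (k - s) * (k.choose s : ℂ))), (0, 0))

/-- `x ⊗ (t−1)^l tʲ ∈ g`. -/
def tpE (l : ℕ) (j : ℤ) (x : 𝕘) : GCar 𝕘 :=
  ((0, 0), (∑ s ∈ Finset.range (l + 1),
      Finsupp.single (j + (s : ℤ)) (((-1 : ℂ) ^ (l - s) * (l.choose s : ℂ)) • x), 0))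

/-- `x ⊗ (t−1)^l tʲξ ∈ g`. -/
def tpF (l : ℕ) (j : ℤ) (x : 𝕘) : GCar 𝕘 :=
  ((0, 0), (0, ∑ s ∈ Finset.range (l + 1),
      Finsupp.single (j + (s : ℤ)) (((-1 : ℂ) ^ (l - s) * (l.choose s : ℂ)) • x)))

/-- The subspace `a_k = (t−1)^{k+1} s̄ ⋉ (ġ ⊗ 𝔪^k A)` of `g`, spanned by
`(t−1)^{k+1}L_i`, `(t−1)^{k+1}G_i`, `x ⊗ (t−1)^k tⁱ`, `x ⊗ (t−1)^k tⁱξ`,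
`x ⊗ (t−1)^{k−1} tⁱξ`. -/
def ak (𝕘 : Type) [LieRing 𝕘] [LieAlgebra ℂ 𝕘] (k : ℕ) : Submodule ℂ (GCar 𝕘) :=
  Submodule.span ℂ
    ({u | ∃ i : ℤ, u = tpL (k + 1) i} ∪ {u | ∃ i : ℤ, u = tpG (k + 1) i}
      ∪ {u | ∃ (i : ℤ) (x : 𝕘), u = tpE k i x}
      ∪ {u | ∃ (i : ℤ) (x : 𝕘), u = tpF k i x}
      ∪ {u | ∃ (i : ℤ) (x : 𝕘), u = tpF (k - 1) i x})

section Laurent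

variable {V : Type*} [AddCommGroup V]

/-- The element `x ⊗ (t-1)^k t^i` of `V ⊗ ℂ[t^{±1}]`. -/
def tpow (k : ℕ) (i : ℤ) (x : V) : ℤ →₀ V :=
  (fwdDiff (1 : ℤ))^[k] (fun n => Finsupp.single n x) i

@[simp] lemma tpow_zero (i : ℤ) (x : V) : tpow 0 i x = Finsupp.single i x := rfl

lemma tpow_succ (k : ℕ) (i : ℤ) (x : V) :
    tpow (k + 1) i x = tpow k (i + 1) x - tpow k i x := by
  simp only [tpow, Function.iterate_succ_apply', fwdDiff]

variable {U X : Type*} [Module ℂ V] [AddCommGroup U] [Module ℂ U] [AddCommGroup X] [Module ℂ X]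

lemma tpow_eq_sum (k : ℕ) (i : ℤ) (x : V) :
    tpow k i x = ∑ s ∈ Finset.range (k + 1),
      Finsupp.single (i + (s : ℤ)) (((-1 : ℂ) ^ (k - s) * (k.choose s : ℂ)) • x) := by
  rw [tpow, fwdDiff_iter_eq_sum_shift]
  refine Finset.sum_congr rfl fun s _ => ?_
  rw [Finsupp.smul_single, ← Int.cast_smul_eq_zsmul ℂ]
  simp

lemma tpow_smul (k : ℕ) (i : ℤ) (c : ℂ) (x : V) : tpow k i (c • x) = c • tpow k i x := by
  induction k generalizing i with
  | zero => simp
  | succ k ih => simp only [tpow_succ, ih, smul_sub]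

variable (V) in
/-- The subspace `V ⊗ (t-1)^k ℂ[t^{±1}]`. -/
def tpowSpan (k : ℕ) : Submodule ℂ (ℤ →₀ V) :=
  Submodule.span ℂ {p | ∃ (i : ℤ) (x : V), p = tpow k i x}

lemma tpow_mem_tpowSpan (k : ℕ) (i : ℤ) (x : V) : tpow k i x ∈ tpowSpan V k :=
  Submodule.subset_span ⟨i, x, rfl⟩

lemma tpowSpan_antitone : Antitone (tpowSpan V) := by
  refine antitone_nat_of_succ_le fun k => Submodule.span_le.2 ?_
  rintro _ ⟨i, x, rfl⟩
  rw [tpow_succ]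
  exact sub_mem (tpow_mem_tpowSpan _ _ _) (tpow_mem_tpowSpan _ _ _)

/-- The bilinear map `(x ⊗ t^i, y ⊗ t^j) ↦ (c + a i + b j) φ(x, y) ⊗ t^{i+j}`. -/
def laurentBilin (c a b : ℂ) (φ : U →ₗ[ℂ] V →ₗ[ℂ] X) :
    (ℤ →₀ U) →ₗ[ℂ] (ℤ →₀ V) →ₗ[ℂ] (ℤ →₀ X) :=
  Finsupp.lsum ℂ fun i => (Finsupp.lsum ℂ).toLinearMap ∘ₗ
    LinearMap.pi fun j => (c + a * i + b * j) • φ.compr₂ (Finsupp.lsingle (i + j))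

lemma laurentBilin_apply (c a b : ℂ) (φ : U →ₗ[ℂ] V →ₗ[ℂ] X) (p : ℤ →₀ U) (q : ℤ →₀ V) :
    laurentBilin c a b φ p q = p.sum fun i x => q.sum fun j y =>
      Finsupp.single (i + j) ((c + a * i + b * j) • φ x y) := by
  simp [laurentBilin, Finsupp.sum, LinearMap.sum_apply]

lemma sum_eq_laurentBilin (c a b : ℂ) (φ : U →ₗ[ℂ] V →ₗ[ℂ] X) {f : ℤ → ℤ → U → V → X}
    (hf : ∀ i j x y, f i j x y = (c + a * i + b * j) • φ x y) (p : ℤ →₀ U) (q : ℤ →₀ V) :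
    (p.sum fun i x => q.sum fun j y => Finsupp.single (i + j) (f i j x y)) =
      laurentBilin c a b φ p q := by
  simp only [laurentBilin_apply, hf]

lemma laurentBilin_tpow (c a b : ℂ) (φ : U →ₗ[ℂ] V →ₗ[ℂ] X) (k l : ℕ) (i j : ℤ)
    (x : U) (y : V) :
    laurentBilin c a b φ (tpow k i x) (tpow l j y) =
      (c + a * i + b * j) • tpow (k + l) (i + j) (φ x y)
        + (a * k + b * l) • tpow (k + l - 1) (i + j + 1) (φ x y) := by
  induction k generalizing i with
  | zero =>
    induction l generalizing j with
    | zero => simp [laurentBilin_apply]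
    | succ l ih =>
      have h : (l : ℂ) • tpow l (i + j + 1) (φ x y) = (l : ℂ) •
          (tpow (l - 1) (i + j + 1 + 1) (φ x y) - tpow (l - 1) (i + j + 1) (φ x y)) := by
        cases l <;> simp [tpow_succ]
      simp only [tpow_succ, map_sub, ih, zero_add, add_tsub_cancel_right, ← add_assoc] at h ⊢
      push_cast
      linear_combination (norm := module) (-b) • h
  | succ k ih =>
    have h : (a * k + b * l) • tpow (k + l) (i + j + 1) (φ x y) = (a * k + b * l) •
        (tpow (k + l - 1) (i + j + 1 + 1) (φ x y) - tpow (k + l - 1) (i + j + 1) (φ x y)) := by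
      obtain h | ⟨m, h⟩ : k + l = 0 ∨ ∃ m, k + l = m + 1 := by
        cases h : k + l <;> simp
      · obtain ⟨rfl, rfl⟩ : k = 0 ∧ l = 0 := by omega
        simp
      · simp [h, tpow_succ]
    have e : k + 1 + l = k + l + 1 := by ring
    simp only [tpow_succ, map_sub, LinearMap.sub_apply, ih, e, add_tsub_cancel_right,
      add_right_comm i 1 j] at h ⊢
    push_cast
    linear_combination (norm := module) -h

lemma laurentBilin_mem (c a b : ℂ) (φ : U →ₗ[ℂ] V →ₗ[ℂ] X) {k l m : ℕ}
    (hm : m ≤ k + l) (h : (a = 0 ∧ b = 0) ∨ m ≤ k + l - 1)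
    {p : ℤ →₀ U} {q : ℤ →₀ V} (hp : p ∈ tpowSpan U k) (hq : q ∈ tpowSpan V l) :
    laurentBilin c a b φ p q ∈ tpowSpan X m := by
  refine Submodule.map₂_le.1 (?_ : Submodule.map₂ (laurentBilin c a b φ) _ _ ≤ _) _ hp _ hq
  rw [tpowSpan, tpowSpan, Submodule.map₂_span_span, Submodule.span_le]
  rintro _ ⟨_, ⟨i, x, rfl⟩, _, ⟨j, y, rfl⟩, rfl⟩
  change laurentBilin c a b φ (tpow k i x) (tpow l j y) ∈ _
  rw [laurentBilin_tpow]
  refine add_mem (Submodule.smul_mem _ _ (tpowSpan_antitone hm (tpow_mem_tpowSpan _ _ _))) ?_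
  obtain ⟨rfl, rfl⟩ | h := h
  · simp
  · exact Submodule.smul_mem _ _ (tpowSpan_antitone h (tpow_mem_tpowSpan _ _ _))

end Laurent

section Superconformal

/-- The action of `ℂ` on `𝕘`, with the vector as the first argument. -/
abbrev smulFlip (𝕘 : Type) [LieRing 𝕘] [LieAlgebra ℂ 𝕘] : 𝕘 →ₗ[ℂ] ℂ →ₗ[ℂ] 𝕘 :=
  (LinearMap.lsmul ℂ 𝕘).flip

/-- The Lie bracket of `𝕘` as a bilinear map. -/
abbrev lieBilin (𝕘 : Type) [LieRing 𝕘] [LieAlgebra ℂ 𝕘] : 𝕘 →ₗ[ℂ] 𝕘 →ₗ[ℂ] 𝕘 :=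
  (LieModule.toEnd ℂ 𝕘 𝕘 : 𝕘 →ₗ[ℂ] Module.End ℂ 𝕘)

lemma gbr_eq_laurentBilin (u v : GCar 𝕘) :
    gbr u v =
      ((laurentBilin 0 (-1) 1 (LinearMap.mul ℂ ℂ) u.1.1 v.1.1
          + laurentBilin (-2) 0 0 (LinearMap.mul ℂ ℂ) u.1.2 v.1.2,
        laurentBilin 0 (-1 / 2) 1 (LinearMap.mul ℂ ℂ) u.1.1 v.1.2
          + laurentBilin 0 (-1) (1 / 2) (LinearMap.mul ℂ ℂ) u.1.2 v.1.1),
       (laurentBilin 0 0 1 (LinearMap.lsmul ℂ 𝕘) u.1.1 v.2.1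
          + laurentBilin 0 (-1) 0 (smulFlip 𝕘) u.2.1 v.1.1
          + laurentBilin (-1) 0 0 (LinearMap.lsmul ℂ 𝕘) u.1.2 v.2.2
          + laurentBilin 1 0 0 (smulFlip 𝕘) u.2.2 v.1.2
          + laurentBilin 1 0 0 (lieBilin 𝕘) u.2.1 v.2.1,
        laurentBilin 0 (1 / 2) 1 (LinearMap.lsmul ℂ 𝕘) u.1.1 v.2.2
          + laurentBilin 0 (-1) (-1 / 2) (smulFlip 𝕘) u.2.2 v.1.1
          + laurentBilin 0 0 1 (LinearMap.lsmul ℂ 𝕘) u.1.2 v.2.1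
          + laurentBilin 0 (-1) 0 (smulFlip 𝕘) u.2.1 v.1.2
          + laurentBilin 1 0 0 (lieBilin 𝕘) u.2.1 v.2.2
          + laurentBilin 1 0 0 (lieBilin 𝕘) u.2.2 v.2.1)) := by
  refine Prod.ext (Prod.ext ?_ ?_) (Prod.ext ?_ ?_)
  all_goals
    dsimp only [gbr]
    repeat' refine congrArg₂ (· + ·) ?_ ?_
    all_goals
      refine sum_eq_laurentBilin _ _ _ _ (fun i j x y => ?_) _ _
      simp [smul_smul] <;> first | ring1 | module

lemma tpL_eq_tpow (k : ℕ) (i : ℤ) : (tpL k i : GCar 𝕘) = ((tpow k i 1, 0), (0, 0)) := by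
  simp [tpL, tpow_eq_sum]

lemma tpG_eq_tpow (k : ℕ) (i : ℤ) : (tpG k i : GCar 𝕘) = ((0, tpow k i 1), (0, 0)) := by
  simp [tpG, tpow_eq_sum]

lemma tpE_eq_tpow (k : ℕ) (i : ℤ) (x : 𝕘) : tpE k i x = ((0, 0), (tpow k i x, 0)) := by
  simp [tpE, tpow_eq_sum]

lemma tpF_eq_tpow (k : ℕ) (i : ℤ) (x : 𝕘) : tpF k i x = ((0, 0), (0, tpow k i x)) := by
  simp [tpF, tpow_eq_sum]

lemma tpL_mem_ak (k : ℕ) (i : ℤ) : tpL (k + 1) i ∈ ak 𝕘 k :=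
  Submodule.subset_span (.inl (.inl (.inl (.inl ⟨i, rfl⟩))))

lemma tpG_mem_ak (k : ℕ) (i : ℤ) : tpG (k + 1) i ∈ ak 𝕘 k :=
  Submodule.subset_span (.inl (.inl (.inl (.inr ⟨i, rfl⟩))))

lemma tpE_mem_ak (k : ℕ) (i : ℤ) (x : 𝕘) : tpE k i x ∈ ak 𝕘 k :=
  Submodule.subset_span (.inl (.inl (.inr ⟨i, x, rfl⟩)))

lemma tpF_mem_ak (k : ℕ) (i : ℤ) (x : 𝕘) : tpF (k - 1) i x ∈ ak 𝕘 k :=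
  Submodule.subset_span (.inr ⟨i, x, rfl⟩)

lemma ak_eq_prod (k : ℕ) :
    ak 𝕘 k = ((tpowSpan ℂ (k + 1)).prod (tpowSpan ℂ (k + 1))).prod
      ((tpowSpan 𝕘 k).prod (tpowSpan 𝕘 (k - 1))) := by
  apply le_antisymm
  · refine Submodule.span_le.2 ?_
    rintro _ ((((⟨i, rfl⟩ | ⟨i, rfl⟩) | ⟨i, x, rfl⟩) | ⟨i, x, rfl⟩) | ⟨i, x, rfl⟩)
    · simp [tpL_eq_tpow, tpow_mem_tpowSpan]
    · simp [tpG_eq_tpow, tpow_mem_tpowSpan]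
    · simp [tpE_eq_tpow, tpow_mem_tpowSpan]
    · simpa [tpF_eq_tpow] using tpowSpan_antitone (Nat.sub_le k 1) (tpow_mem_tpowSpan k i x)
    · simp [tpF_eq_tpow, tpow_mem_tpowSpan]
  · simp only [Submodule.prod_le_iff, Submodule.map_le_iff_le_comap, tpowSpan, Submodule.span_le]
    refine ⟨⟨?_, ?_⟩, ?_, ?_⟩ <;> rintro _ ⟨i, x, rfl⟩
    · change ((tpow (k + 1) i x, 0), (0, 0)) ∈ ak 𝕘 k
      simpa [tpL_eq_tpow, ← tpow_smul] using (ak 𝕘 k).smul_mem x (tpL_mem_ak k i)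
    · change ((0, tpow (k + 1) i x), (0, 0)) ∈ ak 𝕘 k
      simpa [tpG_eq_tpow, ← tpow_smul] using (ak 𝕘 k).smul_mem x (tpG_mem_ak k i)
    · change ((0, 0), (tpow k i x, 0)) ∈ ak 𝕘 k
      exact tpE_eq_tpow k i x ▸ tpE_mem_ak k i x
    · change ((0, 0), (0, tpow (k - 1) i x)) ∈ ak 𝕘 k
      exact tpF_eq_tpow (k - 1) i x ▸ tpF_mem_ak k i x

/-- The subspaces `a_k` form a filtration: `[a_m, a_n] ⊆ a_{m+n}`. -/
lemma gbr_mem_ak {m n l : ℕ} (hl : m + n = l) {u v : GCar 𝕘} (hu : u ∈ ak 𝕘 m)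
    (hv : v ∈ ak 𝕘 n) : gbr u v ∈ ak 𝕘 l := by
  rw [ak_eq_prod] at hu hv ⊢
  obtain ⟨⟨hu₁, hu₂⟩, hu₃, hu₄⟩ := hu
  obtain ⟨⟨hv₁, hv₂⟩, hv₃, hv₄⟩ := hv
  rw [gbr_eq_laurentBilin]
  refine ⟨⟨?_, ?_⟩, ?_, ?_⟩
  all_goals
    repeat' apply add_mem
    all_goals
      apply laurentBilin_mem (hp := by assumption) (hq := by assumption)
      · omega
      · first | (right; omega) | (left; simp)

lemma gbr_tpL_tpG (k l : ℕ) (i j : ℤ) :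
    gbr (tpL k i : GCar 𝕘) (tpG l j) = ((j : ℂ) - i / 2) • tpG (k + l) (i + j)
      + ((l : ℂ) - k / 2) • tpG (k + l - 1) (i + j + 1) := by
  simp [gbr_eq_laurentBilin, tpL_eq_tpow, tpG_eq_tpow, laurentBilin_tpow]
  congr 2 <;> ring

lemma gbr_tpL_tpE (k l : ℕ) (i j : ℤ) (x : 𝕘) :
    gbr (tpL k i) (tpE l j x) = (j : ℂ) • tpE (k + l) (i + j) x
      + (l : ℂ) • tpE (k + l - 1) (i + j + 1) x := by
  simp [gbr_eq_laurentBilin, tpL_eq_tpow, tpE_eq_tpow, laurentBilin_tpow]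

lemma gbr_tpL_tpF (k l : ℕ) (i j : ℤ) (x : 𝕘) :
    gbr (tpL k i) (tpF l j x) = ((j : ℂ) + i / 2) • tpF (k + l) (i + j) x
      + ((l : ℂ) + k / 2) • tpF (k + l - 1) (i + j + 1) x := by
  simp [gbr_eq_laurentBilin, tpL_eq_tpow, tpF_eq_tpow, laurentBilin_tpow]
  congr 2 <;> ring

/-- A subspace containing `(t-1)^k W` and stable under `a₀` contains `a_k`. -/
lemma ak_le_of_tpL_mem (k : ℕ) (N : Submodule ℂ (GCar 𝕘)) (hL : ∀ i : ℤ, tpL k i ∈ N)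
    (hN : ∀ u ∈ ak 𝕘 0, ∀ v ∈ N, gbr v u ∈ N) : ak 𝕘 k ≤ N := by
  have hF (i : ℤ) (x : 𝕘) : tpF k i x ∈ N := by
    have h₀ := hN _ (tpF_mem_ak 0 0 x) _ (hL i)
    have h₁ := hN _ (tpF_mem_ak 0 1 x) _ (hL (i - 1))
    have h : (1 / 2 : ℂ) • tpF k i x =
        gbr (tpL k (i - 1)) (tpF 0 1 x) - gbr (tpL k i) (tpF 0 0 x) := by
      simp [gbr_tpL_tpF]
      module
    exact (N.smul_mem_iff (by norm_num)).1 (h ▸ sub_mem h₁ h₀)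
  refine Submodule.span_le.2 ?_
  rintro _ ((((⟨i, rfl⟩ | ⟨i, rfl⟩) | ⟨i, x, rfl⟩) | ⟨i, x, rfl⟩) | ⟨i, x, rfl⟩)
  · have h : (tpL (k + 1) i : GCar 𝕘) = tpL k (i + 1) - tpL k i := by
      simp [tpL_eq_tpow, tpow_succ]
    rw [h]
    exact sub_mem (hL _) (hL _)
  · have h₀ := hN _ (tpG_mem_ak 0 0) _ (hL i)
    have h₁ := hN _ (tpG_mem_ak 0 1) _ (hL (i - 1))
    have h : (3 / 2 : ℂ) • (tpG (k + 1) i : GCar 𝕘) =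
        gbr (tpL k (i - 1)) (tpG 1 1) - gbr (tpL k i) (tpG 1 0) := by
      simp [gbr_tpL_tpG]
      module
    exact (N.smul_mem_iff (by norm_num)).1 (h ▸ sub_mem h₁ h₀)
  · have h := hN _ (tpE_mem_ak 0 1 x) _ (hL (i - 1))
    simpa [gbr_tpL_tpE] using h
  · exact hF i x
  · obtain rfl | hk := eq_or_ne k 0
    · exact hF i x
    · have h := hN _ (tpF_mem_ak 0 0 x) _ (hL (i - 1))
      rw [gbr_tpL_tpF] at h
      have h' := N.smul_mem (2 / k : ℂ) ((N.add_mem_iff_right (N.smul_mem _ (hF _ _))).1 h)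
      convert h' using 1
      simp [smul_smul, hk]

end Superconformal

/-- **Statement 12.** For `k ∈ ℤ₊` let `a_k = (t−1)^{k+1} s̄ ⋉ (ġ ⊗ 𝔪^k A) ⊆ g`.
Then:
(1) `a₀` is a Lie super subalgebra of `g`;
(2) `a_k` is an ideal of `a₀`;
(3) `[a₁, a_k] ⊆ a_{k+1}`;
(4) the ideal of `a₀` generated by `(t−1)^k W` contains `a_k` (where
`W = span{L_i}` is the Witt algebra). -/
theorem ak_filtration_properties
    (𝕘 : Type) [LieRing 𝕘] [LieAlgebra ℂ 𝕘] [FiniteDimensional ℂ 𝕘]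
    [LieAlgebra.IsSimple ℂ 𝕘] :
    (∀ u ∈ ak 𝕘 0, ∀ v ∈ ak 𝕘 0, gbr u v ∈ ak 𝕘 0) ∧
    (∀ k : ℕ, ∀ u ∈ ak 𝕘 0, ∀ v ∈ ak 𝕘 k, gbr u v ∈ ak 𝕘 k ∧ gbr v u ∈ ak 𝕘 k) ∧
    (∀ k : ℕ, ∀ u ∈ ak 𝕘 1, ∀ v ∈ ak 𝕘 k,
      gbr u v ∈ ak 𝕘 (k + 1) ∧ gbr v u ∈ ak 𝕘 (k + 1)) ∧
    (∀ k : ℕ, ∀ N : Submodule ℂ (GCar 𝕘),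
      (∀ i : ℤ, tpL k i ∈ N) →
      (∀ u ∈ ak 𝕘 0, ∀ v ∈ N, gbr u v ∈ N ∧ gbr v u ∈ N) →
      ak 𝕘 k ≤ N) := by
  refine ⟨fun u hu v hv => ?_, fun k u hu v hv => ⟨?_, ?_⟩, fun k u hu v hv => ⟨?_, ?_⟩,
    fun k N hL hN => ak_le_of_tpL_mem k N hL fun u hu v hv => (hN u hu v hv).2⟩
  · exact gbr_mem_ak (add_zero 0) hu hv
  · exact gbr_mem_ak (zero_add k) hu hv
  · exact gbr_mem_ak (add_zero k) hv hu
  · exact gbr_mem_ak (add_comm 1 k) hu hv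
  · exact gbr_mem_ak rfl hv hu
end
end

section
/- Any finite-dimensional simple module V over the Lie superalgebra R⋉ġ restricts to a finite-dimensional simple ġ-module, with X acting on V as a scalar b ∈ ℂ and Y acting by zero. -/
/-!
Representations of the centerless superconformal current algebra
`g = s̄ ⋉ (ġ ⊗ A)`, where `s̄` is the centerless `N = 1` Ramond algebra and
`A = ℂ[t^{±1}] ⊗ Λ(ξ)`.  A representation is encoded by the operators by which
the basis elements `L i`, `G i`, `x ⊗ tⁱ` (operator `E i x`) and `x ⊗ tⁱξ`
(operator `F i x`) act, subject to the supercommutator relations.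
-/

noncomputable section

open Module

variable (𝕘 : Type) [LieRing 𝕘] [LieAlgebra ℂ 𝕘]

/-- The operators `L, G, E, F` on `M` form a representation of
`g = s̄ ⋉ (ġ ⊗ A)`. -/
structure IsGRep {M : Type} [AddCommGroup M] [Module ℂ M]
    (L G : ℤ → End ℂ M) (E F : ℤ → 𝕘 →ₗ[ℂ] End ℂ M) : Prop where
  comm_LL : ∀ i j : ℤ, L i * L j - L j * L i = ((j : ℂ) - (i : ℂ)) • L (i + j)
  comm_LG : ∀ i j : ℤ, L i * G j - G j * L i = ((j : ℂ) - (i : ℂ) / 2) • G (i + j)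
  comm_GG : ∀ i j : ℤ, G i * G j + G j * G i = (-2 : ℂ) • L (i + j)
  comm_LE : ∀ (i j : ℤ) (x : 𝕘), L i * E j x - E j x * L i = (j : ℂ) • E (i + j) x
  comm_LF : ∀ (i j : ℤ) (x : 𝕘),
      L i * F j x - F j x * L i = ((j : ℂ) + (i : ℂ) / 2) • F (i + j) x
  comm_GE : ∀ (i j : ℤ) (x : 𝕘), G i * E j x - E j x * G i = (j : ℂ) • F (i + j) x
  comm_GF : ∀ (i j : ℤ) (x : 𝕘), G i * F j x + F j x * G i = - E (i + j) x
  comm_EE : ∀ (i j : ℤ) (x y : 𝕘), E i x * E j y - E j y * E i x = E (i + j) ⁅x, y⁆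
  comm_FE : ∀ (i j : ℤ) (x y : 𝕘), F i x * E j y - E j y * F i x = F (i + j) ⁅x, y⁆
  comm_FF : ∀ (i j : ℤ) (x y : 𝕘), F i x * F j y + F j y * F i x = 0

/-- An endomorphism has parity `p` with respect to a `ℤ/2`-grading. -/
def MapsGr {M : Type} [AddCommGroup M] [Module ℂ M]
    (gr : Fin 2 → Submodule ℂ M) (p : Fin 2) (f : End ℂ M) : Prop :=
  ∀ q, (gr q).map f ≤ gr (q + p)

/-- The grading `gr` makes `M` into a super vector space on which the operator
families act with the correct parities. -/
structure IsGSuper {M : Type} [AddCommGroup M] [Module ℂ M]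
    (gr : Fin 2 → Submodule ℂ M)
    (L G : ℤ → End ℂ M) (E F : ℤ → 𝕘 →ₗ[ℂ] End ℂ M) : Prop where
  internal : DirectSum.IsInternal gr
  hL : ∀ i, MapsGr gr 0 (L i)
  hG : ∀ i, MapsGr gr 1 (G i)
  hE : ∀ (i : ℤ) (x : 𝕘), MapsGr gr 0 (E i x)
  hF : ∀ (i : ℤ) (x : 𝕘), MapsGr gr 1 (F i x)

/-- `M` is a weight module: `L₀` acts diagonalizably. -/
def IsWeightMod {M : Type} [AddCommGroup M] [Module ℂ M] (L0 : End ℂ M) : Prop :=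
  ⨆ μ : ℂ, L0.eigenspace μ = ⊤

/-- `M` is cuspidal (uniformly bounded): a weight module whose weight space
dimensions admit a uniform finite bound. -/
def IsCuspidalMod {M : Type} [AddCommGroup M] [Module ℂ M] (L0 : End ℂ M) : Prop :=
  IsWeightMod L0 ∧ ∃ N : ℕ, ∀ μ : ℂ, Module.rank ℂ (L0.eigenspace μ) ≤ N

/-- The set of all operators in the image of a representation of `g`. -/
def gOps {M : Type} [AddCommGroup M] [Module ℂ M]
    (L G : ℤ → End ℂ M) (E F : ℤ → 𝕘 →ₗ[ℂ] End ℂ M) : Set (End ℂ M) :=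
  Set.range L ∪ Set.range G
    ∪ {f | ∃ (i : ℤ) (x : 𝕘), f = E i x} ∪ {f | ∃ (i : ℤ) (x : 𝕘), f = F i x}

/-- A subspace is invariant under a set of operators. -/
def InvariantUnder {M : Type} [AddCommGroup M] [Module ℂ M]
    (S : Set (End ℂ M)) (N : Submodule ℂ M) : Prop :=
  ∀ f ∈ S, N.map f ≤ N

/-- A subspace is graded (homogeneous) with respect to the grading `gr`. -/
def GradedSub {M : Type} [AddCommGroup M] [Module ℂ M]
    (gr : Fin 2 → Submodule ℂ M) (N : Submodule ℂ M) : Prop :=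
  N ≤ (N ⊓ gr 0) ⊔ (N ⊓ gr 1)

/-- Simplicity: `M ≠ 0` and the only graded subspaces invariant under all the
operators are `0` and `M`. -/
def IsSimpleRep {M : Type} [AddCommGroup M] [Module ℂ M]
    (S : Set (End ℂ M)) (gr : Fin 2 → Submodule ℂ M) : Prop :=
  (∃ v : M, v ≠ 0) ∧
    ∀ N : Submodule ℂ M, InvariantUnder S N → GradedSub gr N → N = ⊥ ∨ N = ⊤

/-! ### Modules over `R ⋉ ġ`

`R` is the two-dimensional Lie superalgebra with even basis element `X`, odd
basis element `Y` and only nonzero bracket `[X, Y] = (1/2) Y`; in `R ⋉ ġ` one has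
`[X, ġ] = [Y, ġ] = 0`. -/

/-- The operators `X`, `Y`, `ρ` make `V` into a module over `R ⋉ ġ`. -/
structure IsRGRep {V : Type} [AddCommGroup V] [Module ℂ V]
    (X Y : End ℂ V) (ρ : 𝕘 →ₗ[ℂ] End ℂ V) : Prop where
  comm_XY : X * Y - Y * X = ((1 : ℂ) / 2) • Y
  anticomm_YY : Y * Y + Y * Y = 0
  comm_Xg : ∀ x : 𝕘, X * ρ x = ρ x * X
  comm_Yg : ∀ x : 𝕘, Y * ρ x = ρ x * Y
  rep_g : ∀ x y : 𝕘, ρ x * ρ y - ρ y * ρ x = ρ ⁅x, y⁆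

/-- Compatibility of an `R ⋉ ġ`-module structure with a super grading. -/
structure IsRGSuper {V : Type} [AddCommGroup V] [Module ℂ V]
    (grV : Fin 2 → Submodule ℂ V) (X Y : End ℂ V) (ρ : 𝕘 →ₗ[ℂ] End ℂ V) : Prop where
  internal : DirectSum.IsInternal grV
  hX : MapsGr grV 0 X
  hY : MapsGr grV 1 Y
  hg : ∀ x : 𝕘, MapsGr grV 0 (ρ x)

/-- The set of operators of an `R ⋉ ġ`-module structure. -/
def rgOps {V : Type} [AddCommGroup V] [Module ℂ V]
    (X Y : End ℂ V) (ρ : 𝕘 →ₗ[ℂ] End ℂ V) : Set (End ℂ V) :=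
  {X, Y} ∪ {f | ∃ x : 𝕘, f = ρ x}


section Graded

variable {M : Type} [AddCommGroup M] [Module ℂ M] {gr : Fin 2 → Submodule ℂ M}

/-- The two homogeneous components of a `ℤ/2`-graded space are complementary. -/
theorem isCompl_of_isInternal (h : DirectSum.IsInternal gr) : IsCompl (gr 0) (gr 1) :=
  h.isCompl (i := 0) (j := 1) (by decide) (by ext i; fin_cases i <;> simp)

/-- A homogeneous endomorphism has a graded kernel. -/
theorem MapsGr.gradedSub_ker (h : DirectSum.IsInternal gr) {p : Fin 2} {f : End ℂ M}
    (hf : MapsGr gr p f) : GradedSub gr (LinearMap.ker f) := by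
  have hc := isCompl_of_isInternal h
  have hd : Disjoint (gr (0 + p)) (gr (1 + p)) :=
    h.submodule_iSupIndep.pairwiseDisjoint (by simp)
  intro v hv
  obtain ⟨a, ha, b, hb, rfl⟩ := Submodule.mem_sup.1 (hc.sup_eq_top ▸ Submodule.mem_top (x := v))
  have hfa : f a ∈ gr (0 + p) := hf 0 (Submodule.mem_map_of_mem ha)
  have hfb : f b ∈ gr (1 + p) := hf 1 (Submodule.mem_map_of_mem hb)
  have hab : f a + f b = 0 := by rw [← map_add]; exact hv
  have ha0 : f a = 0 := Submodule.disjoint_def.1 hd _ hfa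
    (eq_neg_of_add_eq_zero_left hab ▸ neg_mem hfb)
  have hb0 : f b = 0 := by simpa [ha0] using hab
  exact Submodule.add_mem_sup ⟨ha0, ha⟩ ⟨hb0, hb⟩

/-- Subtracting a scalar preserves even endomorphisms. -/
theorem MapsGr.sub_algebraMap {f : End ℂ M} (hf : MapsGr gr 0 f) (b : ℂ) :
    MapsGr gr 0 (f - algebraMap ℂ (End ℂ M) b) := by
  rintro q _ ⟨v, hv, rfl⟩
  have hfv : f v ∈ gr q := by simpa using hf q (Submodule.mem_map_of_mem hv)
  simpa [Module.algebraMap_end_apply] using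
    sub_mem hfv ((gr q).smul_mem b hv)

/-- A homogeneous component is a graded subspace. -/
theorem gradedSub_zero : GradedSub gr (gr 0) := by
  simp [GradedSub]

/-- If the even component is trivial or everything, then every subspace is graded. -/
theorem gradedSub_of_eq_bot_or_eq_top (h : DirectSum.IsInternal gr)
    (h0 : gr 0 = ⊥ ∨ gr 0 = ⊤) (N : Submodule ℂ M) : GradedSub gr N := by
  rcases h0 with h0 | h0
  · have h1 : gr 1 = ⊤ := by simpa [h0] using (isCompl_of_isInternal h).sup_eq_top
    simp [GradedSub, h1]
  · simp [GradedSub, h0]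

end Graded

/-- Invariance under `R ⋉ ġ` amounts to invariance under `X`, `Y` and `ġ`. -/
theorem invariantUnder_rgOps_iff {V : Type} [AddCommGroup V] [Module ℂ V]
    {X Y : End ℂ V} {ρ : 𝕘 →ₗ[ℂ] End ℂ V} {N : Submodule ℂ V} :
    InvariantUnder (rgOps 𝕘 X Y ρ) N ↔
      N.map X ≤ N ∧ N.map Y ≤ N ∧ ∀ x, N.map (ρ x) ≤ N := by
  constructor
  · intro h
    exact ⟨h X (by simp [rgOps]), h Y (by simp [rgOps]), fun x => h _ (Or.inr ⟨x, rfl⟩)⟩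
  · rintro ⟨hX, hY, hρ⟩ f ((rfl | rfl) | ⟨x, rfl⟩)
    exacts [hX, hY, hρ x]

/-- The kernel of an endomorphism is stable under every endomorphism commuting with it. -/
theorem map_ker_le_of_commute {V : Type} [AddCommGroup V] [Module ℂ V] {f g : End ℂ V}
    (h : Commute f g) : (LinearMap.ker f).map g ≤ LinearMap.ker f := by
  rintro _ ⟨v, hv, rfl⟩
  have hv : f v = 0 := hv
  simpa [hv] using LinearMap.congr_fun h.eq v

section SimpleModule

variable {V : Type} [AddCommGroup V] [Module ℂ V]
  {X Y : End ℂ V} {ρ : 𝕘 →ₗ[ℂ] End ℂ V} {grV : Fin 2 → Submodule ℂ V}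

/-- The odd element acts by zero on a simple module. -/
theorem odd_eq_zero_of_isSimpleRep (hrep : IsRGRep 𝕘 X Y ρ) (hsuper : IsRGSuper 𝕘 grV X Y ρ)
    (hsimple : IsSimpleRep (rgOps 𝕘 X Y ρ) grV) : Y = 0 := by
  obtain ⟨⟨v, hv⟩, hsub⟩ := hsimple
  have hYY : Y * Y = 0 := by
    have h := hrep.anticomm_YY
    rw [← two_smul ℂ] at h
    exact (smul_eq_zero.1 h).resolve_left two_ne_zero
  have hinv : InvariantUnder (rgOps 𝕘 X Y ρ) (LinearMap.ker Y) := by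
    refine (invariantUnder_rgOps_iff 𝕘).2 ⟨?_, map_ker_le_of_commute (Commute.refl Y),
      fun x => map_ker_le_of_commute (hrep.comm_Yg x)⟩
    rintro _ ⟨w, hw, rfl⟩
    have hw : Y w = 0 := hw
    simpa [hw] using LinearMap.congr_fun hrep.comm_XY w
  rcases hsub _ hinv (hsuper.hY.gradedSub_ker hsuper.internal) with h | h
  · have hYv : Y v ∈ LinearMap.ker Y := LinearMap.congr_fun hYY v
    rw [h] at hYv
    have hvY : v ∈ LinearMap.ker Y := hYv
    rw [h] at hvY
    exact absurd hvY hv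
  · exact LinearMap.ker_eq_top.1 h

/-- The even element of `R` acts by a scalar on a finite-dimensional simple module. -/
theorem even_eq_smul_one_of_isSimpleRep [FiniteDimensional ℂ V] (hrep : IsRGRep 𝕘 X Y ρ)
    (hsuper : IsRGSuper 𝕘 grV X Y ρ) (hsimple : IsSimpleRep (rgOps 𝕘 X Y ρ) grV) :
    ∃ b : ℂ, X = b • (1 : End ℂ V) := by
  have hY := odd_eq_zero_of_isSimpleRep 𝕘 hrep hsuper hsimple
  obtain ⟨⟨v, hv⟩, hsub⟩ := hsimple
  have : Nontrivial V := ⟨v, 0, hv⟩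
  obtain ⟨b, hb⟩ := Module.End.exists_eigenvalue X
  have hcomm {f : End ℂ V} (hf : Commute X f) :
      Commute (X - algebraMap ℂ (End ℂ V) b) f :=
    hf.sub_left (Algebra.commute_algebraMap_left b f)
  have hinv : InvariantUnder (rgOps 𝕘 X Y ρ)
      (LinearMap.ker (X - algebraMap ℂ (End ℂ V) b)) :=
    (invariantUnder_rgOps_iff 𝕘).2 ⟨map_ker_le_of_commute (hcomm (Commute.refl X)),
      by simp [hY], fun x => map_ker_le_of_commute (hcomm (hrep.comm_Xg x))⟩
  rcases hsub _ hinv ((hsuper.hX.sub_algebraMap b).gradedSub_ker hsuper.internal) with h | h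
  · exact absurd (Module.End.eigenspace_def.trans h) hb
  · exact ⟨b, (sub_eq_zero.1 (LinearMap.ker_eq_top.1 h)).trans
      (Algebra.algebraMap_eq_smul_one b)⟩

end SimpleModule

/-- **Statement 16.** Any finite-dimensional simple module `V` over the Lie
superalgebra `R ⋉ ġ` restricts to a finite-dimensional simple `ġ`-module, with
`X` acting on `V` as a scalar `b ∈ ℂ` and `Y` acting by zero. -/
theorem simple_RG_module_structure
    (𝕘 : Type) [LieRing 𝕘] [LieAlgebra ℂ 𝕘] [FiniteDimensional ℂ 𝕘]
    [LieAlgebra.IsSimple ℂ 𝕘]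
    (V : Type) [AddCommGroup V] [Module ℂ V] [FiniteDimensional ℂ V]
    (X Y : End ℂ V) (ρ : 𝕘 →ₗ[ℂ] End ℂ V)
    (grV : Fin 2 → Submodule ℂ V)
    (hrep : IsRGRep 𝕘 X Y ρ)
    (hsuper : IsRGSuper 𝕘 grV X Y ρ)
    (hsimple : IsSimpleRep (rgOps 𝕘 X Y ρ) grV) :
    ((∃ v : V, v ≠ 0) ∧
      ∀ N : Submodule ℂ V, (∀ x : 𝕘, N.map (ρ x) ≤ N) → N = ⊥ ∨ N = ⊤) ∧
    (∃ b : ℂ, X = b • (1 : End ℂ V)) ∧ Y = 0 := by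
  have hY := odd_eq_zero_of_isSimpleRep 𝕘 hrep hsuper hsimple
  obtain ⟨b, hb⟩ := even_eq_smul_one_of_isSimpleRep 𝕘 hrep hsuper hsimple
  refine ⟨⟨hsimple.1, fun N hN => ?_⟩, ⟨b, hb⟩, hY⟩
  have hinv {N : Submodule ℂ V} (hN : ∀ x, N.map (ρ x) ≤ N) :
      InvariantUnder (rgOps 𝕘 X Y ρ) N := by
    refine (invariantUnder_rgOps_iff 𝕘).2 ⟨?_, by simp [hY], hN⟩
    rintro _ ⟨v, hv, rfl⟩
    simpa [hb] using N.smul_mem b hv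
  have h0 : grV 0 = ⊥ ∨ grV 0 = ⊤ :=
    hsimple.2 _ (hinv fun x => by simpa using hsuper.hg x 0) gradedSub_zero
  exact hsimple.2 N (hinv hN) (gradedSub_of_eq_bot_or_eq_top hsuper.internal h0 N)
end
end

section
/- Any finite-dimensional simple module over the three-dimensional Lie superalgebra R⋉ℂZ is one-dimensional, spanned by a vector v with X·v = bv, Y·v = 0, Z·v = dv for some b,d ∈ ℂ. -/
/-!
`R ⋉ ℂZ` is the three-dimensional complex Lie superalgebra with even part
spanned by `X` and `Z`, odd part spanned by `Y`, and only nonzero bracket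
`[X, Y] = (1/2) Y` (`Z` central).  A module over it is encoded by three
operators `X, Y, Z` satisfying the supercommutator relations, together with a
compatible super grading.
-/

noncomputable section

open Module

/-- The operators `X, Y, Z` make `V` into a module over `R ⋉ ℂZ`. -/
structure IsRZRep {V : Type} [AddCommGroup V] [Module ℂ V]
    (X Y Z : End ℂ V) : Prop where
  comm_XY : X * Y - Y * X = ((1 : ℂ) / 2) • Y
  anticomm_YY : Y * Y + Y * Y = 0
  comm_XZ : X * Z = Z * X
  comm_YZ : Y * Z = Z * Y

/-- Compatibility with a super grading: `X, Z` are even, `Y` is odd. -/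
structure IsRZSuper {V : Type} [AddCommGroup V] [Module ℂ V]
    (grV : Fin 2 → Submodule ℂ V) (X Y Z : End ℂ V) : Prop where
  internal : DirectSum.IsInternal grV
  hX : MapsGr grV 0 X
  hY : MapsGr grV 1 Y
  hZ : MapsGr grV 0 Z

theorem exists_eigenvector_mem {V : Type} [AddCommGroup V] [Module ℂ V] [FiniteDimensional ℂ V]
    (f : End ℂ V) (N : Submodule ℂ V) (hN : N ≠ ⊥) (hf : ∀ x ∈ N, f x ∈ N) :
    ∃ c : ℂ, ∃ v ∈ N, v ≠ 0 ∧ f v = c • v := by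
  have : Nontrivial N := Submodule.nontrivial_iff_ne_bot.mpr hN
  obtain ⟨c, hc⟩ := Module.End.exists_eigenvalue (f.restrict hf)
  obtain ⟨v, hv⟩ := hc.exists_hasEigenvector
  refine ⟨c, v, v.2, fun h => hv.2 (Subtype.ext h), ?_⟩
  simpa using congrArg Subtype.val hv.apply_eq_smul

theorem isCompl_of_isInternal_fin_two {V : Type} [AddCommGroup V] [Module ℂ V]
    {gr : Fin 2 → Submodule ℂ V} (h : DirectSum.IsInternal gr) : IsCompl (gr 0) (gr 1) :=
  h.isCompl (by decide) (by ext i; fin_cases i <;> simp)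

/-- The kernel of an odd operator is a graded subspace. -/
theorem gradedSub_ker_of_odd {V : Type} [AddCommGroup V] [Module ℂ V]
    {gr : Fin 2 → Submodule ℂ V} (h : IsCompl (gr 0) (gr 1)) {f : End ℂ V}
    (hf : MapsGr gr 1 f) : GradedSub gr (LinearMap.ker f) := by
  intro v hv
  obtain ⟨a, ha, b, hb, rfl⟩ := Submodule.mem_sup.mp
    (h.sup_eq_top.symm ▸ Submodule.mem_top : v ∈ gr 0 ⊔ gr 1)
  have hfa : f a ∈ gr 1 := hf 0 (Submodule.mem_map_of_mem ha)
  have hfb : f b ∈ gr 0 := hf 1 (Submodule.mem_map_of_mem hb)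
  have hab : f a + f b = 0 := by simpa using hv
  have hb0 : f b = 0 := by
    refine Submodule.disjoint_def.mp h.disjoint _ hfb ?_
    rw [eq_neg_of_add_eq_zero_right hab]
    exact (gr 1).neg_mem hfa
  have ha0 : f a = 0 := by simpa [hb0] using hab
  exact Submodule.add_mem_sup ⟨ha0, ha⟩ ⟨hb0, hb⟩

/-- A line spanned by a homogeneous vector is a graded subspace. -/
theorem gradedSub_span_singleton {V : Type} [AddCommGroup V] [Module ℂ V]
    {gr : Fin 2 → Submodule ℂ V} {i : Fin 2} {v : V} (hv : v ∈ gr i) :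
    GradedSub gr (Submodule.span ℂ {v}) := by
  have hle : Submodule.span ℂ {v} ≤ Submodule.span ℂ {v} ⊓ gr i :=
    le_inf le_rfl ((Submodule.span_singleton_le_iff_mem _ _).mpr hv)
  fin_cases i
  · exact hle.trans le_sup_left
  · exact hle.trans le_sup_right

/-- In a simple module the odd operator `Y` acts by zero. -/
theorem odd_operator_eq_zero {V : Type} [AddCommGroup V] [Module ℂ V]
    {X Y Z : End ℂ V} {grV : Fin 2 → Submodule ℂ V}
    (hrep : IsRZRep X Y Z) (hsuper : IsRZSuper grV X Y Z)
    (hsimple : IsSimpleRep ({X, Y, Z} : Set (End ℂ V)) grV) : Y = 0 := by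
  obtain ⟨⟨w, hw⟩, hsub⟩ := hsimple
  have hYY (x : V) : Y (Y x) = 0 := by
    have h := LinearMap.congr_fun hrep.anticomm_YY x
    simpa [← two_smul ℂ] using h
  have hinv : InvariantUnder ({X, Y, Z} : Set (End ℂ V)) (LinearMap.ker Y) := by
    rintro f (rfl | rfl | rfl) _ ⟨x, hx, rfl⟩
    · have hx0 : Y x = 0 := hx
      have h := LinearMap.congr_fun hrep.comm_XY x
      simpa [hx0] using h
    · exact hYY x
    · have hx0 : Y x = 0 := hx
      have h := LinearMap.congr_fun hrep.comm_YZ x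
      simpa [hx0] using h
  rcases hsub _ hinv (gradedSub_ker_of_odd
    (isCompl_of_isInternal_fin_two hsuper.internal) hsuper.hY) with h | h
  · have hinj := LinearMap.ker_eq_bot.mp h
    have h0 := (map_eq_zero_iff Y hinj).mp (hYY w)
    exact absurd ((map_eq_zero_iff Y hinj).mp h0) hw
  · exact LinearMap.ker_eq_top.mp h

/-- **Statement 17.** Any finite-dimensional simple module over the
three-dimensional Lie superalgebra `R ⋉ ℂZ` is one-dimensional, spanned by a
vector `v` with `X v = b v`, `Y v = 0`, `Z v = d v` for some `b, d ∈ ℂ`. -/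
theorem simple_RZ_module_is_one_dimensional
    (V : Type) [AddCommGroup V] [Module ℂ V] [FiniteDimensional ℂ V]
    (X Y Z : End ℂ V) (grV : Fin 2 → Submodule ℂ V)
    (hrep : IsRZRep X Y Z)
    (hsuper : IsRZSuper grV X Y Z)
    (hsimple : IsSimpleRep ({X, Y, Z} : Set (End ℂ V)) grV) :
    Module.finrank ℂ V = 1 ∧
    ∃ v : V, v ≠ 0 ∧ Submodule.span ℂ {v} = ⊤ ∧
      ∃ b d : ℂ, X v = b • v ∧ Y v = 0 ∧ Z v = d • v := by
  obtain rfl : Y = 0 := odd_operator_eq_zero hrep hsuper hsimple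
  obtain ⟨⟨w, hw⟩, hsub⟩ := hsimple
  obtain ⟨i, hi⟩ : ∃ i, grV i ≠ ⊥ := by
    by_contra! h
    have htop := (isCompl_of_isInternal_fin_two hsuper.internal).sup_eq_top
    rw [h 0, h 1, sup_bot_eq] at htop
    exact hw ((Submodule.mem_bot ℂ).mp (htop ▸ Submodule.mem_top))
  have hX : ∀ x ∈ grV i, X x ∈ grV i := fun x hx => by
    simpa using hsuper.hX i (Submodule.mem_map_of_mem hx)
  have hZ : ∀ x ∈ grV i, Z x ∈ grV i := fun x hx => by
    simpa using hsuper.hZ i (Submodule.mem_map_of_mem hx)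
  obtain ⟨b, u, hu, hu0, hXu⟩ := exists_eigenvector_mem X (grV i) hi hX
  obtain ⟨d, v, ⟨hv, hvb⟩, hv0, hZv⟩ := exists_eigenvector_mem Z (grV i ⊓ X.eigenspace b)
    ((Submodule.ne_bot_iff _).mpr ⟨u, ⟨hu, Module.End.mem_eigenspace_iff.mpr hXu⟩, hu0⟩) (by
      rintro x ⟨hx, hxb⟩
      refine ⟨hZ x hx, Module.End.mem_eigenspace_iff.mpr ?_⟩
      have h : X (Z x) = Z (X x) := LinearMap.congr_fun hrep.comm_XZ x
      rw [h, Module.End.mem_eigenspace_iff.mp hxb, map_smul])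
  have hXv : X v = b • v := Module.End.mem_eigenspace_iff.mp hvb
  have hspan : Submodule.span ℂ {v} = ⊤ := by
    refine (hsub _ ?_ (gradedSub_span_singleton hv)).resolve_left (by simpa using hv0)
    rintro f (rfl | rfl | rfl) <;>
      rw [Submodule.map_span, Set.image_singleton, Submodule.span_singleton_le_iff_mem]
    · exact hXv ▸ Submodule.smul_mem _ b (Submodule.mem_span_singleton_self v)
    · exact Submodule.zero_mem _
    · exact hZv ▸ Submodule.smul_mem _ d (Submodule.mem_span_singleton_self v)
  refine ⟨?_, v, hv0, hspan, b, d, hXv, rfl, hZv⟩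
  rw [← finrank_top, ← hspan, finrank_span_singleton hv0]
end
end
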